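/- Let G be a locally finite Borel graph on a standard Borel space X such that no connected component of G is a Gallai tree. Then G is Borel degree-list-colorable: for every Polish space Y and every Borel function L : X → [Y]^{<∞} with |L(x)| equal to the degree of x for every x ∈ X, there is a Borel map c : X → Y such that c(x) ∈ L(x) for all x and c(x) ≠ c(y) whenever x and y are adjacent. -/

import Mathlib

open MeasureTheory

/-- A partial function `f : B → X` is *one-ended* if there is no infinite sequence
`x₀, x₁, x₂, …` of points of `B` with `f (x_{i+1}) = x_i` for all `i`. -/
def OneEnded {X : Type*} {B : Set X} (f : B → X) : Prop :=
  ¬ ∃ u : ℕ → B, ∀ i : ℕ, f (u (i + 1)) = (u i : X)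

/-- A set of vertices is `G`-invariant if it is a union of connected components of `G`. -/
def GraphInvariant {X : Type*} (G : SimpleGraph X) (A : Set X) : Prop :=
  ∀ ⦃x y : X⦄, G.Reachable x y → x ∈ A → y ∈ A

/-- `[A]_{E_G}`: the union of all connected components of `G` meeting `A`. -/
def EGSat {X : Type*} (G : SimpleGraph X) (A : Set X) : Set X :=
  {x | ∃ a ∈ A, G.Reachable x a}

/-- `S` is biconnected: the induced subgraph on `S` is connected and remains connected
(in the sense of `Preconnected`) after deleting any single vertex of `S`. -/
def BiconnectedSet {X : Type*} (G : SimpleGraph X) (S : Set X) : Prop :=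
  (G.induce S).Connected ∧ ∀ x ∈ S, (G.induce (S \ {x})).Preconnected

/-- A block of `G` is a maximal biconnected set. -/
def GraphBlock {X : Type*} (G : SimpleGraph X) (S : Set X) : Prop :=
  BiconnectedSet G S ∧ ∀ T : Set X, BiconnectedSet G T → S ⊆ T → T = S

/-- The induced subgraph on `S` is a cycle of odd length. -/
def OddCycleSet {X : Type*} (G : SimpleGraph X) (S : Set X) : Prop :=
  ∃ n : ℕ, Odd n ∧ 3 ≤ n ∧ Nonempty (G.induce S ≃g SimpleGraph.cycleGraph n)

/-- A Gallai tree is a connected graph each of whose blocks induces a complete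
graph or an odd cycle. -/
def GallaiTree {X : Type*} (G : SimpleGraph X) : Prop :=
  G.Connected ∧ ∀ S : Set X, GraphBlock G S → G.IsClique S ∨ OddCycleSet G S

/-- A graph is ample if every vertex has degree at least 2 and for every vertex `x`,
every connected component of the restriction of `G` to the complement of `{x}`
contains a vertex of degree at least 3 in that restriction. -/
def AmpleGraph {X : Type*} (G : SimpleGraph X) : Prop :=
  (∀ x : X, 2 ≤ (G.neighborSet x).encard) ∧
  ∀ x : X, ∀ y : ({x}ᶜ : Set X), ∃ z : ({x}ᶜ : Set X),
    (G.induce ({x}ᶜ : Set X)).Reachable y z ∧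
      3 ≤ ((G.induce ({x}ᶜ : Set X)).neighborSet z).encard

/-- `x E^even_G y`: `x` and `y` are joined by a path of even length in `G`. -/
def EvenRel {X : Type*} (G : SimpleGraph X) (x y : X) : Prop :=
  ∃ p : G.Walk x y, p.IsPath ∧ Even p.length

/-- A set is `E^even_G`-invariant if it is a union of `E^even_G`-classes. -/
def EvenInvariant {X : Type*} (G : SimpleGraph X) (C : Set X) : Prop :=
  ∀ ⦃x y : X⦄, EvenRel G x y → x ∈ C → y ∈ C


namespace DegreeList

section Choosability

open scoped Classical

variable {V W Y : Type*}

/-- The degree of `x` in the subgraph induced on `S`, for `x` any vertex. -/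
noncomputable def degOn (G : SimpleGraph V) (S : Finset V) (x : V) : ℕ :=
  (S.filter (G.Adj x)).card

/-- The subgraph induced on `S` has a proper colouring from the lists `L`. -/
def ListColorable (G : SimpleGraph V) (S : Finset V) (L : V → Finset Y) : Prop :=
  ∃ c : V → Y, (∀ x ∈ S, c x ∈ L x) ∧ ∀ x ∈ S, ∀ y ∈ S, G.Adj x y → c x ≠ c y

/-- The subgraph induced on `S` is colourable from all lists whose sizes exceed the degrees
by at least `f`. -/
def ExcessChoosable (Y : Type*) (G : SimpleGraph V) (f : V → ℕ) (S : Finset V) : Prop :=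
  ∀ L : V → Finset Y, (∀ x ∈ S, degOn G S x + f x ≤ (L x).card) → ListColorable G S L

lemma degOn_insert {G : SimpleGraph V} {S : Finset V} {v : V} (hv : v ∉ S) (u : V) :
    degOn G (insert v S) u = degOn G S u + if G.Adj u v then 1 else 0 := by
  unfold degOn
  rw [Finset.filter_insert]
  split_ifs with h
  · rw [Finset.card_insert_of_notMem (by simp [hv])]
  · rfl

lemma ListColorable.insert {G : SimpleGraph V} {S : Finset V} {L : V → Finset Y} {v : V} {α : Y}
    (hv : v ∉ S) (hα : α ∈ L v)
    (h : ListColorable G S fun u => if G.Adj u v then (L u).erase α else L u) :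
    ListColorable G (insert v S) L := by
  obtain ⟨c, hc, hadj⟩ := h
  have hne : ∀ u ∈ S, u ≠ v := fun u hu h => hv (h ▸ hu)
  have hmem : ∀ u ∈ S, c u ∈ L u := fun u hu => by
    have := hc u hu
    dsimp only at this
    split_ifs at this
    · exact Finset.mem_of_mem_erase this
    · exact this
  have hα' : ∀ u ∈ S, G.Adj u v → c u ≠ α := fun u hu huv => by
    have := hc u hu
    dsimp only at this
    rw [if_pos huv] at this
    exact Finset.ne_of_mem_erase this
  refine ⟨Function.update c v α, ?_, ?_⟩
  · intro x hx
    rcases Finset.mem_insert.1 hx with rfl | hx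
    · simpa using hα
    · rw [Function.update_of_ne (hne x hx)]
      exact hmem x hx
  · intro x hx y hy hxy
    rcases Finset.mem_insert.1 hx with hxv | hxS <;> rcases Finset.mem_insert.1 hy with hyv | hyS
    · exact absurd (hxv.trans hyv.symm) hxy.ne
    · subst hxv
      rw [Function.update_self, Function.update_of_ne (hne y hyS)]
      exact (hα' y hyS hxy.symm).symm
    · subst hyv
      rw [Function.update_self, Function.update_of_ne (hne x hxS)]
      exact hα' x hxS hxy
    · rw [Function.update_of_ne (hne x hxS), Function.update_of_ne (hne y hyS)]
      exact hadj x hxS y hyS hxy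

lemma ExcessChoosable.insert {G : SimpleGraph V} {f : V → ℕ} {S : Finset V}
    (h : ExcessChoosable Y G f S) {v t : V} (hv : v ∉ S) (ht : t ∈ S) (hvt : G.Adj v t) :
    ExcessChoosable Y G f (insert v S) := by
  intro L hL
  have hpos : 0 < (L v).card := by
    refine lt_of_lt_of_le ?_ (hL v (Finset.mem_insert_self _ _))
    refine Nat.lt_of_lt_of_le ?_ (Nat.le_add_right _ _)
    exact Finset.card_pos.2 ⟨t, by simp [ht, hvt]⟩
  obtain ⟨α, hα⟩ := Finset.card_pos.1 hpos
  refine ListColorable.insert hv hα (h _ fun x hx => ?_)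
  have := hL x (Finset.mem_insert_of_mem hx)
  rw [degOn_insert hv] at this
  split_ifs with hxv
  · rw [if_pos hxv] at this
    have := Finset.pred_card_le_card_erase (s := L x) (a := α)
    omega
  · rw [if_neg hxv] at this
    omega

/-- Every adjacency-invariant predicate is constant on `T`; see `pConn_iff`. -/
def PConn (G : SimpleGraph V) (T : Set V) : Prop :=
  ∀ P : V → Prop, (∀ a ∈ T, ∀ b ∈ T, G.Adj a b → (P a ↔ P b)) → ∀ a ∈ T, ∀ b ∈ T, P a → P b

lemma pConn_iff {G : SimpleGraph V} {T : Set V} : PConn G T ↔ (G.induce T).Preconnected := by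
  constructor
  · intro h a b
    have := h (fun v => ∃ hv : v ∈ T, (G.induce T).Reachable a ⟨v, hv⟩) ?_ a a.2 b b.2
      ⟨a.2, SimpleGraph.Reachable.refl _⟩
    · exact this.2
    · intro u hu v hv huv
      have hadj : (G.induce T).Adj ⟨u, hu⟩ ⟨v, hv⟩ := huv
      exact ⟨fun ⟨_, h⟩ => ⟨hv, h.trans hadj.reachable⟩,
        fun ⟨_, h⟩ => ⟨hu, h.trans hadj.symm.reachable⟩⟩
  · intro h P hP a ha b hb hPa
    obtain ⟨p⟩ := h ⟨a, ha⟩ ⟨b, hb⟩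
    have key : ∀ u v : T, (G.induce T).Walk u v → P u → P v := by
      intro u v p
      induction p with
      | nil => exact id
      | cons hadj _ ih => exact fun hu => ih ((hP _ (Subtype.coe_prop _) _ (Subtype.coe_prop _) hadj).1 hu)
    exact key _ _ p hPa

lemma ExcessChoosable.mono {G : SimpleGraph V} {f : V → ℕ} {S T : Finset V}
    (h : ExcessChoosable Y G f S) (hST : S ⊆ T) (hS : S.Nonempty) (hT : PConn G (T : Set V)) :
    ExcessChoosable Y G f T := by
  induction hn : (T \ S).card generalizing S with
  | zero =>
    have : T ⊆ S := Finset.sdiff_eq_empty_iff_subset.1 (Finset.card_eq_zero.1 hn)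
    rwa [← hST.antisymm this]
  | succ n ih =>
    obtain ⟨w, hw⟩ : (T \ S).Nonempty := Finset.card_pos.1 (by omega)
    obtain ⟨hwT, hwS⟩ := Finset.mem_sdiff.1 hw
    obtain ⟨s, hs⟩ := hS
    obtain ⟨v, t, hvT, hvS, ht, hvt⟩ :
        ∃ v t, v ∈ T ∧ v ∉ S ∧ t ∈ S ∧ G.Adj v t := by
      by_contra! hcon
      refine hwS (hT (fun v => v ∈ S) (fun a ha b hb hab => ⟨fun h1 => ?_, fun h1 => ?_⟩)
        s (hST hs) w hwT hs)
      · by_contra h2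
        exact hcon b a hb h2 h1 hab.symm
      · by_contra h2
        exact hcon a b ha h2 h1 hab
    refine ih (h.insert hvS ht hvt) (Finset.insert_subset hvT hST) (Finset.insert_nonempty _ _) ?_
    have h3 : T \ Insert.insert v S = (T \ S).erase v := by ext; simp; tauto
    rw [h3, Finset.card_erase_of_mem (Finset.mem_sdiff.2 ⟨hvT, hvS⟩), hn, Nat.add_sub_cancel]

lemma excessChoosable_singleton (G : SimpleGraph V) (y : V) :
    ExcessChoosable Y G (fun v => if v = y then 1 else 0) {y} := by
  intro L hL
  have := hL y (Finset.mem_singleton_self y)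
  simp only [if_true] at this
  obtain ⟨α, hα⟩ := Finset.card_pos.1 (by omega : 0 < (L y).card)
  refine ⟨fun _ => α, by simpa using hα, fun a ha b hb hab => ?_⟩
  rw [Finset.mem_singleton.1 ha, Finset.mem_singleton.1 hb] at hab
  exact absurd hab (G.loopless.irrefl _)

/-- A finite set is biconnected, in terms of `PConn`. -/
def PBiconn (G : SimpleGraph V) (T : Set V) : Prop :=
  PConn G T ∧ ∀ x ∈ T, PConn G (T \ {x})

lemma lists_eq_of_not_listColorable {G : SimpleGraph V} {S : Finset V} {L : V → Finset Y}
    (hS : PBiconn G (S : Set V)) (hL : ∀ x ∈ S, degOn G S x ≤ (L x).card)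
    (h : ¬ ListColorable G S L) :
    (∀ x ∈ S, (L x).card = degOn G S x) ∧ ∀ x ∈ S, ∀ y ∈ S, L x = L y := by
  have hcard : ∀ x ∈ S, (L x).card = degOn G S x := by
    intro y hy
    by_contra hne
    refine h ((excessChoosable_singleton G y).mono (Finset.singleton_subset_iff.2 hy)
      (Finset.singleton_nonempty y) hS.1 L fun x hx => ?_)
    have := hL x hx
    dsimp only
    split_ifs with hxy
    · subst hxy
      omega
    · omega
  have hsub : ∀ x ∈ S, ∀ y ∈ S, G.Adj x y → L x ⊆ L y := by
    intro x hx y hy hxy α hα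
    by_contra hαy
    have hyx : y ≠ x := hxy.ne'
    have hins : insert x (S.erase x) = S := Finset.insert_erase hx
    have hnot : x ∉ S.erase x := Finset.notMem_erase x S
    refine h (hins ▸ ListColorable.insert hnot hα ?_)
    refine (excessChoosable_singleton G y).mono (T := S.erase x) ?_
      (Finset.singleton_nonempty y) ?_ _ fun v hv => ?_
    · exact Finset.singleton_subset_iff.2 (Finset.mem_erase.2 ⟨hyx, hy⟩)
    · rw [Finset.coe_erase]
      exact hS.2 x hx
    · have h1 := hL v (Finset.mem_of_mem_erase hv)
      rw [← hins, degOn_insert hnot] at h1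
      by_cases hvy : v = y
      · subst hvy
        rw [if_pos hxy.symm] at h1
        dsimp only
        rw [if_pos hxy.symm, if_pos rfl, Finset.erase_eq_of_notMem hαy]
        exact h1
      · dsimp only
        rw [if_neg hvy]
        split_ifs with hvx
        · rw [if_pos hvx] at h1
          have := Finset.pred_card_le_card_erase (s := L v) (a := α)
          omega
        · rw [if_neg hvx] at h1
          exact h1
  refine ⟨hcard, fun x hx y hy => ?_⟩
  refine hS.1 (fun v => L x = L v) (fun a ha b hb hab => ?_) x hx y hy rfl
  rw [(hsub a ha b hb hab).antisymm (hsub b hb a ha hab.symm)]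

lemma choosable_of_degOn_ne {G : SimpleGraph V} {S : Finset V} (hS : PBiconn G (S : Set V))
    {a b : V} (ha : a ∈ S) (hb : b ∈ S) (hab : degOn G S a ≠ degOn G S b) :
    ExcessChoosable Y G 0 S := by
  intro L hL
  by_contra hcon
  obtain ⟨h1, h2⟩ := lists_eq_of_not_listColorable hS hL hcon
  apply hab
  rw [← h1 a ha, ← h1 b hb, h2 a ha b hb]

lemma choosable_of_two_coloring {G : SimpleGraph V} {S : Finset V} (hS : PBiconn G (S : Set V))
    (hne : S.Nonempty) (hdeg : ∀ v ∈ S, degOn G S v = 2) (p : V → Prop)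
    (hp : ∀ u ∈ S, ∀ v ∈ S, G.Adj u v → (p u ↔ ¬ p v)) :
    ExcessChoosable Y G 0 S := by
  intro L hL
  by_contra hcon
  obtain ⟨h1, h2⟩ := lists_eq_of_not_listColorable hS hL hcon
  obtain ⟨s, hs⟩ := hne
  obtain ⟨α, β, hαβ, hLs⟩ := Finset.card_eq_two.1 ((h1 s hs).trans (hdeg s hs))
  refine hcon ⟨fun v => if p v then α else β, fun v hv => ?_, fun u hu v hv huv => ?_⟩
  · rw [h2 v hv s hs, hLs]
    dsimp only
    split_ifs <;> simp
  · have := hp u hu v hv huv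
    by_cases hv : p v
    · simp [this, hv, hαβ.symm]
    · simp [this, hv, hαβ]

/-- Choosability transfers along isomorphisms of induced subgraphs. -/
lemma ExcessChoosable.of_iso {G : SimpleGraph V} {H : SimpleGraph W} {S : Finset V} {T : Finset W}
    (h : ExcessChoosable Y G 0 S) (φ : V → W) (ψ : W → V)
    (hφ : ∀ v ∈ S, φ v ∈ T) (hψ : ∀ w ∈ T, ψ w ∈ S) (hψφ : ∀ v ∈ S, ψ (φ v) = v)
    (hφψ : ∀ w ∈ T, φ (ψ w) = w)
    (hadj : ∀ u ∈ S, ∀ v ∈ S, G.Adj u v ↔ H.Adj (φ u) (φ v)) :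
    ExcessChoosable Y H 0 T := by
  intro L hL
  obtain ⟨c, hc, hne⟩ := h (fun v => L (φ v)) fun v hv => by
    refine le_trans ?_ (hL (φ v) (hφ v hv))
    refine Nat.add_le_add ?_ le_rfl
    refine Finset.card_le_card_of_injOn φ ?_ ?_
    · intro u hu
      simp only [Finset.coe_filter, Set.mem_ofPred_eq] at hu ⊢
      exact ⟨hφ u hu.1, (hadj v hv u hu.1).1 hu.2⟩
    · intro u hu u' hu' huu
      simp only [Finset.coe_filter, Set.mem_ofPred_eq] at hu hu'
      rw [← hψφ u hu.1, ← hψφ u' hu'.1, huu]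
  refine ⟨fun w => c (ψ w), fun w hw => ?_, fun u hu v hv huv => ?_⟩
  · simpa [hφψ w hw] using hc _ (hψ w hw)
  · refine hne _ (hψ u hu) _ (hψ v hv) ((hadj _ (hψ u hu) _ (hψ v hv)).2 ?_)
    rwa [hφψ u hu, hφψ v hv]

end Choosability
section Structure

open scoped Classical

variable {V W Y : Type*}

lemma PConn.iff {G : SimpleGraph V} {T : Set V} (h : PConn G T) {P : V → Prop}
    (hP : ∀ a ∈ T, ∀ b ∈ T, G.Adj a b → (P a ↔ P b)) {a b : V} (ha : a ∈ T) (hb : b ∈ T) :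
    P a ↔ P b :=
  ⟨h P hP a ha b hb, h P hP b hb a ha⟩

lemma pConn_of_hub {G : SimpleGraph V} {T : Set V}
    (h : ∀ P : V → Prop, (∀ a ∈ T, ∀ b ∈ T, G.Adj a b → (P a ↔ P b)) →
      ∃ p : Prop, ∀ t ∈ T, (P t ↔ p)) : PConn G T := by
  intro P hP a ha b hb hPa
  obtain ⟨p, hp⟩ := h P hP
  exact (hp b hb).2 ((hp a ha).1 hPa)

lemma PConn.exists_boundary {G : SimpleGraph V} {T : Set V} (h : PConn G T) {P : V → Prop}
    {a b : V} (ha : a ∈ T) (hb : b ∈ T) (hPa : P a) (hPb : ¬ P b) :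
    ∃ u ∈ T, ∃ v ∈ T, G.Adj u v ∧ P u ∧ ¬ P v := by
  by_contra! hcon
  exact hPb (h P (fun u hu v hv huv =>
    ⟨hcon u hu v hv huv, hcon v hv u hu huv.symm⟩) a ha b hb hPa)

lemma pBiconn_pair {G : SimpleGraph V} {x y : V} (h : G.Adj x y) : PBiconn G {x, y} := by
  refine ⟨pConn_of_hub fun P hP => ⟨P x, ?_⟩, fun v hv => pConn_of_hub fun P hP => ?_⟩
  · rintro t (rfl | rfl)
    · rfl
    · exact (hP x (by simp) t (by simp) h).symm
  · rcases hv with rfl | rfl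
    · refine ⟨P y, ?_⟩
      rintro t ⟨rfl | rfl, ht⟩
      · exact absurd rfl ht
      · rfl
    · refine ⟨P x, ?_⟩
      rintro t ⟨rfl | rfl, ht⟩
      · rfl
      · exact absurd rfl ht

lemma iff_left_of_chain {G : SimpleGraph V} {T : Set V} {P : V → Prop}
    (hP : ∀ a ∈ T, ∀ b ∈ T, G.Adj a b → (P a ↔ P b)) {q : ℕ → V} {a : V} {n : ℕ} (ha : a ∈ T)
    (hq : ∀ i ≤ n, q i ∈ T) (hadj : ∀ i < n, G.Adj (q i) (q (i + 1))) (h0 : G.Adj a (q 0)) :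
    ∀ i ≤ n, (P (q i) ↔ P a) := by
  intro i hi
  induction i with
  | zero => exact (hP a ha _ (hq 0 hi) h0).symm
  | succ i ih =>
    rw [← ih (by omega)]
    exact (hP _ (hq i (by omega)) _ (hq _ hi) (hadj i (by omega))).symm

/-- Attaching a path to a biconnected set at two different vertices. -/
lemma PBiconn.ear {G : SimpleGraph V} {S : Set V} (hS : PBiconn G S) {a b : V} (ha : a ∈ S)
    (hb : b ∈ S) (hab : a ≠ b) {k : ℕ} {q : ℕ → V} (hq : ∀ i ≤ k, q i ∉ S)
    (hinj : ∀ i ≤ k, ∀ j ≤ k, q i = q j → i = j) (hadj : ∀ i < k, G.Adj (q i) (q (i + 1)))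
    (h0 : G.Adj a (q 0)) (hk : G.Adj b (q k)) : PBiconn G (S ∪ q '' {i | i ≤ k}) := by
  have hqT : ∀ i ≤ k, q i ∈ S ∪ q '' {i | i ≤ k} := fun i hi => Or.inr ⟨i, hi, rfl⟩
  have right : ∀ (T : Set V) (P : V → Prop), (∀ a ∈ T, ∀ b ∈ T, G.Adj a b → (P a ↔ P b)) →
      ∀ n, b ∈ T → (∀ i, n ≤ i → i ≤ k → q i ∈ T) → ∀ i, n ≤ i → i ≤ k → (P (q i) ↔ P b) := by
    intro T P hP n hbT hT i hni hik
    have := iff_left_of_chain hP (q := fun j => q (k - j)) (n := k - n) hbT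
      (fun j hj => hT _ (by omega) (by omega)) (fun j hj => ?_) (by simpa using hk) (k - i)
      (by omega)
    · simpa [Nat.sub_sub_self hik] using this
    · have h1 := hadj (k - (j + 1)) (by omega)
      rw [show k - (j + 1) + 1 = k - j by omega] at h1
      exact h1.symm
  refine ⟨pConn_of_hub fun P hP => ⟨P a, ?_⟩, fun x hx => pConn_of_hub fun P hP => ?_⟩
  · rintro t (ht | ⟨i, hi, rfl⟩)
    · exact hS.1.iff (fun u hu v hv => hP u (Or.inl hu) v (Or.inl hv)) ht ha
    · exact iff_left_of_chain hP (Or.inl ha) hqT hadj h0 i hi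
  · by_cases hxS : x ∈ S
    · have hne : ∀ i ≤ k, q i ≠ x := fun i hi h => hq i hi (h ▸ hxS)
      by_cases hxa : a = x
      · have hbx : b ≠ x := fun h => hab (hxa.trans h.symm)
        refine ⟨P b, ?_⟩
        rintro t ⟨ht | ⟨i, hi, rfl⟩, htx⟩
        · exact (hS.2 x hxS).iff (fun u hu v hv => hP u ⟨Or.inl hu.1, hu.2⟩ v ⟨Or.inl hv.1, hv.2⟩)
            ⟨ht, htx⟩ ⟨hb, hbx⟩
        · exact right _ P hP 0 ⟨Or.inl hb, hbx⟩ (fun i _ hi => ⟨hqT i hi, hne i hi⟩) i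
            (Nat.zero_le _) hi
      · refine ⟨P a, ?_⟩
        rintro t ⟨ht | ⟨i, hi, rfl⟩, htx⟩
        · exact (hS.2 x hxS).iff (fun u hu v hv => hP u ⟨Or.inl hu.1, hu.2⟩ v ⟨Or.inl hv.1, hv.2⟩)
            ⟨ht, htx⟩ ⟨ha, hxa⟩
        · exact iff_left_of_chain hP ⟨Or.inl ha, hxa⟩ (fun i hi => ⟨hqT i hi, hne i hi⟩) hadj h0
            i hi
    · obtain ⟨j, hj, rfl⟩ : x ∈ q '' {i | i ≤ k} := hx.resolve_left hxS
      have hne : ∀ s ∈ S, s ≠ q j := fun s hs h => hxS (h ▸ hs)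
      have hSx : ∀ s ∈ S, s ∈ (S ∪ q '' {i | i ≤ k}) \ {q j} := fun s hs =>
        ⟨Or.inl hs, hne s hs⟩
      have hSP : ∀ s ∈ S, ∀ t ∈ S, (P s ↔ P t) := fun s hs t ht =>
        hS.1.iff (fun u hu v hv => hP u (hSx u hu) v (hSx v hv)) hs ht
      refine ⟨P a, ?_⟩
      rintro t ⟨ht | ⟨i, hi, rfl⟩, htx⟩
      · exact hSP t ht a ha
      · have hij : i ≠ j := fun h => htx (h ▸ rfl)
        rcases lt_or_gt_of_ne hij with hlt | hlt
        · refine iff_left_of_chain (n := i) hP (hSx a ha) (fun l hl => ⟨hqT l (hl.trans hi), ?_⟩)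
            (fun l hl => hadj l (lt_of_lt_of_le hl hi)) h0 i le_rfl
          exact fun h => by have := hinj l (hl.trans hi) j hj h; omega
        · rw [hSP a ha b hb]
          refine right _ P hP i (hSx b hb) (fun l hl hlk => ⟨hqT l hlk, ?_⟩) i le_rfl hi
          exact fun h => by have := hinj l hlk j hj h; omega

lemma exists_induced_path {G : SimpleGraph V} {T : Set V} {y z : T}
    (h : (G.induce T).Reachable y z) :
    ∃ (m : ℕ) (p : ℕ → V), p 0 = y ∧ p m = z ∧ (∀ i, p i ∈ T) ∧
      (∀ i < m, G.Adj (p i) (p (i + 1))) ∧ (∀ i ≤ m, ∀ j ≤ m, p i = p j → i = j) ∧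
      ∀ i ≤ m, ∀ j ≤ m, G.Adj (p i) (p j) → j ≤ i + 1 := by
  obtain ⟨w, hw⟩ := h.exists_walk_length_eq_dist
  have hdist : ∀ i ≤ w.length, (G.induce T).dist y (w.getVert i) = i := by
    intro i hi
    have h1 := SimpleGraph.dist_le (w.take i)
    have h2 := SimpleGraph.dist_le (w.drop i)
    have h3 := (w.take i).reachable.dist_triangle_left z
    rw [SimpleGraph.Walk.take_length] at h1
    rw [SimpleGraph.Walk.drop_length] at h2
    omega
  refine ⟨w.length, fun i => w.getVert i, by simp, by simp, fun i => Subtype.coe_prop _,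
    fun i hi => w.adj_getVert_succ hi, fun i hi j hj hij => ?_, fun i hi j hj hij => ?_⟩
  · rw [← hdist i hi, ← hdist j hj, Subtype.ext hij]
  · have hadj : (G.induce T).Adj (w.getVert i) (w.getVert j) := hij
    have h3 := (w.take i).reachable.dist_triangle_left (w.getVert j)
    rw [hdist i hi, hdist j hj, SimpleGraph.dist_eq_one_iff_adj.2 hadj] at h3
    exact h3

end Structure
section Cycles

open scoped Classical

variable {V Y : Type*}

/-- `r 0, …, r (n - 1)` is a (not necessarily induced) cycle of length `n`. -/
def IsCyc (G : SimpleGraph V) (n : ℕ) (r : ℕ → V) : Prop :=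
  (∀ i < n, ∀ j < n, r i = r j → i = j) ∧ (∀ i, i + 1 < n → G.Adj (r i) (r (i + 1))) ∧
    G.Adj (r 0) (r (n - 1))

lemma IsCyc.pBiconn {G : SimpleGraph V} {n : ℕ} {r : ℕ → V} (h : IsCyc G n r) (hn : 3 ≤ n) :
    PBiconn G (((Finset.range n).image r : Finset V) : Set V) := by
  obtain ⟨hinj, hadj, hlast⟩ := h
  have := (pBiconn_pair hlast).ear (a := r 0) (b := r (n - 1)) (by simp) (by simp) hlast.ne
    (k := n - 3) (q := fun i => r (i + 1)) ?_ ?_ ?_ ?_ ?_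
  · convert this using 1
    ext v
    simp only [Finset.coe_image, Finset.coe_range, Set.mem_image, Set.mem_Iio, Set.mem_union,
      Set.mem_insert_iff, Set.mem_singleton_iff, Set.mem_ofPred_eq]
    constructor
    · rintro ⟨i, hi, rfl⟩
      by_cases h0 : i = 0
      · exact Or.inl (Or.inl (by rw [h0]))
      · by_cases h1 : i = n - 1
        · exact Or.inl (Or.inr (by rw [h1]))
        · exact Or.inr ⟨i - 1, by omega, by congr 1; omega⟩
    · rintro ((rfl | rfl) | ⟨i, hi, rfl⟩)
      · exact ⟨0, by omega, rfl⟩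
      · exact ⟨n - 1, by omega, rfl⟩
      · exact ⟨i + 1, by omega, rfl⟩
  · rintro i hi (h | h)
    · have := hinj _ (by omega) _ (by omega) h
      omega
    · have := hinj _ (by omega) _ (by omega) h
      omega
  · intro i hi j hj hij
    have := hinj _ (by omega) _ (by omega) hij
    omega
  · exact fun i hi => hadj _ (by omega)
  · exact hadj 0 (by omega)
  · have := hadj (n - 2) (by omega)
    rw [show n - 2 + 1 = n - 1 by omega] at this
    rw [show n - 3 + 1 = n - 2 by omega]
    exact this.symm

lemma eq_or_eq_of_degOn_eq_two {G : SimpleGraph V} {S : Finset V} {v a b w : V}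
    (h : degOn G S v = 2) (ha : a ∈ S) (hb : b ∈ S) (hw : w ∈ S) (hab : a ≠ b)
    (hva : G.Adj v a) (hvb : G.Adj v b) (hvw : G.Adj v w) : w = a ∨ w = b := by
  have hsub : ({a, b} : Finset V) ⊆ S.filter (G.Adj v) := by
    intro u hu
    rcases Finset.mem_insert.1 hu with rfl | hu
    · simp [*]
    · rw [Finset.mem_singleton.1 hu]
      simp [*]
  have heq := Finset.eq_of_subset_of_card_le hsub (by
    rw [Finset.card_pair hab]; exact h.le)
  have : w ∈ ({a, b} : Finset V) := by rw [heq]; simp [*]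
  simpa using this

lemma IsCyc.adj_iff {G : SimpleGraph V} {n : ℕ} {r : ℕ → V} (h : IsCyc G n r) (hn : 3 ≤ n)
    (hdeg : ∀ v ∈ (Finset.range n).image r, degOn G ((Finset.range n).image r) v = 2)
    {i j : ℕ} (hij : i < j) (hj : j < n) :
    G.Adj (r i) (r j) ↔ j = i + 1 ∨ (i = 0 ∧ j = n - 1) := by
  obtain ⟨hinj, hadj, hlast⟩ := h
  have hmem : ∀ k < n, r k ∈ (Finset.range n).image r := fun k hk =>
    Finset.mem_image_of_mem r (Finset.mem_range.2 hk)
  constructor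
  · intro hr
    rcases Nat.eq_zero_or_pos i with rfl | hi
    · have hne : r 1 ≠ r (n - 1) := fun h => by
        have := hinj _ (by omega) _ (by omega) h
        omega
      rcases eq_or_eq_of_degOn_eq_two (hdeg _ (hmem 0 (by omega))) (hmem 1 (by omega))
        (hmem (n - 1) (by omega)) (hmem j hj) hne (hadj 0 (by omega)) hlast hr with h | h
      · exact Or.inl (hinj _ (by omega) _ (by omega) h)
      · exact Or.inr ⟨rfl, hinj _ (by omega) _ (by omega) h⟩
    · have hne : r (i - 1) ≠ r (i + 1) := fun h => by
        have := hinj _ (by omega) _ (by omega) h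
        omega
      have h1 := hadj (i - 1) (by omega)
      rw [show i - 1 + 1 = i by omega] at h1
      rcases eq_or_eq_of_degOn_eq_two (hdeg _ (hmem i (by omega))) (hmem (i - 1) (by omega))
        (hmem (i + 1) (by omega)) (hmem j hj) hne h1.symm (hadj i (by omega)) hr with h | h
      · have := hinj _ (by omega) _ (by omega) h
        omega
      · exact Or.inl (hinj _ (by omega) _ (by omega) h)
  · rintro (rfl | ⟨rfl, rfl⟩)
    · exact hadj i hj
    · exact hlast

lemma IsCyc.choosable_of_even {G : SimpleGraph V} {n : ℕ} {r : ℕ → V} (h : IsCyc G n r)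
    (hn : 3 ≤ n) (hdeg : ∀ v ∈ (Finset.range n).image r, degOn G ((Finset.range n).image r) v = 2)
    (heven : Even n) : ExcessChoosable Y G 0 ((Finset.range n).image r) := by
  have hpar : ∀ i < n, ((∃ k < n, Even k ∧ r k = r i) ↔ Even i) := fun i hi =>
    ⟨fun ⟨k, hk, hke, hki⟩ => h.1 k hk i hi hki ▸ hke, fun hie => ⟨i, hi, hie, rfl⟩⟩
  have key : ∀ i j, i < j → j < n → G.Adj (r i) (r j) → (Even i ↔ ¬ Even j) := by
    intro i j hij hj hadj
    rcases (h.adj_iff hn hdeg hij hj).1 hadj with rfl | ⟨rfl, rfl⟩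
    · rw [Nat.even_add_one, not_not]
    · obtain ⟨l, rfl⟩ := heven
      simp only [Even.zero, true_iff, Nat.not_even_iff_odd]
      exact ⟨l - 1, by omega⟩
  refine choosable_of_two_coloring (h.pBiconn hn) ⟨r 0, ?_⟩ hdeg
    (fun v => ∃ k < n, Even k ∧ r k = v) ?_
  · exact Finset.mem_image_of_mem r (Finset.mem_range.2 (by omega))
  · intro u hu v hv huv
    obtain ⟨i, hi, rfl⟩ := Finset.mem_image.1 hu
    obtain ⟨j, hj, rfl⟩ := Finset.mem_image.1 hv
    rw [Finset.mem_range] at hi hj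
    rw [hpar i hi, hpar j hj]
    rcases lt_trichotomy i j with hij | rfl | hij
    · exact key i j hij hj huv
    · exact absurd huv (G.loopless.irrefl _)
    · have := key j i hij hi huv.symm
      tauto

lemma IsCyc.oddCycleSet {G : SimpleGraph V} {n : ℕ} {r : ℕ → V} (h : IsCyc G n r)
    (hn : 3 ≤ n) (hdeg : ∀ v ∈ (Finset.range n).image r, degOn G ((Finset.range n).image r) v = 2)
    (hodd : Odd n) : OddCycleSet G (((Finset.range n).image r : Finset V) : Set V) := by
  set C : Set V := (((Finset.range n).image r : Finset V) : Set V) with hC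
  have hmem : ∀ k : Fin n, r k ∈ C := fun k =>
    Finset.mem_coe.2 (Finset.mem_image_of_mem r (Finset.mem_range.2 k.2))
  have key : ∀ i j : Fin n, i < j →
      (G.Adj (r i) (r j) ↔ (SimpleGraph.cycleGraph n).Adj i j) := by
    intro i j hij
    have hlt : (i : ℕ) < j := hij
    rw [h.adj_iff hn hdeg hlt j.2, SimpleGraph.cycleGraph_adj',
      Fin.coe_sub_iff_lt.2 hij, Fin.coe_sub_iff_le.2 hij.le]
    have := j.2
    omega
  let f : Fin n → C := fun k => ⟨r k, hmem k⟩
  have hf : Function.Bijective f := by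
    constructor
    · intro i j hij
      exact Fin.ext (h.1 i i.2 j j.2 (congrArg Subtype.val hij))
    · rintro ⟨v, hv⟩
      obtain ⟨i, hi, rfl⟩ := Finset.mem_image.1 (Finset.mem_coe.1 hv)
      exact ⟨⟨i, Finset.mem_range.1 hi⟩, rfl⟩
  refine ⟨n, hodd, hn, ⟨SimpleGraph.Iso.symm ⟨Equiv.ofBijective f hf, ?_⟩⟩⟩
  intro i j
  change G.Adj (r i) (r j) ↔ _
  rcases lt_trichotomy i j with hij | rfl | hij
  · exact key i j hij
  · simp
  · rw [G.adj_comm, key j i hij, SimpleGraph.adj_comm]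

lemma exists_isCyc {G : SimpleGraph V} {B : Set V} (hB : PBiconn G B) (hcl : ¬ G.IsClique B) :
    ∃ (n : ℕ) (r : ℕ → V), 4 ≤ n ∧ IsCyc G n r ∧ (∀ i < n, r i ∈ B) ∧
      degOn G ((Finset.range n).image r) (r 0) = 2 := by
  obtain ⟨y, hy, z, hz, hyz, hnadj⟩ : ∃ y ∈ B, ∃ z ∈ B, y ≠ z ∧ ¬ G.Adj y z := by
    by_contra! hcon
    exact hcl fun y hy z hz hyz => hcon y hy z hz hyz
  obtain ⟨x, hx, z, hz, hxz, hPx, hPz⟩ := hB.1.exists_boundary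
    (P := fun w => w = y ∨ G.Adj y w) hy hz (Or.inl rfl) (by tauto)
  push Not at hPz
  have hyx : G.Adj y x := hPx.resolve_left fun h => hPz.2 (h ▸ hxz)
  have hyT : y ∈ B \ {x} := ⟨hy, hyx.ne⟩
  have hzT : z ∈ B \ {x} := ⟨hz, hxz.ne'⟩
  obtain ⟨m, p, hp0, hpm, hpT, hpadj, hpinj, hpind⟩ :=
    exists_induced_path (pConn_iff.1 (hB.2 x hx) ⟨y, hyT⟩ ⟨z, hzT⟩)
  dsimp only at hp0 hpm
  have hm : 2 ≤ m := by
    by_contra! hlt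
    interval_cases m
    · exact hPz.1 (hpm ▸ hp0)
    · have := hpadj 0 (by omega)
      rw [hp0, hpm] at this
      exact hPz.2 this
  have hpx : ∀ i, p i ≠ x := fun i => (hpT i).2
  have hr : ∀ i ≤ m, (if i ≤ m then p i else x) = p i := fun i hi => if_pos hi
  have hrx : (if m + 1 ≤ m then p (m + 1) else x) = x := if_neg (by omega)
  have hcyc : IsCyc G (m + 2) fun i => if i ≤ m then p i else x := by
    refine ⟨fun i hi j hj hij => ?_, fun i hi => ?_, ?_⟩
    · dsimp only at hij
      split_ifs at hij with h1 h2 h2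
      · exact hpinj i h1 j h2 hij
      · exact absurd hij (hpx i)
      · exact absurd hij.symm (hpx j)
      · omega
    · dsimp only
      rw [hr i (by omega)]
      split_ifs with h1
      · exact hpadj i (by omega)
      · rw [show i = m by omega, hpm]
        exact hxz.symm
    · dsimp only
      rw [show m + 2 - 1 = m + 1 by omega, hrx, hr 0 (by omega), hp0]
      exact hyx
  refine ⟨m + 2, fun i => if i ≤ m then p i else x, by omega, hcyc, fun i _ => ?_, ?_⟩
  · dsimp only
    split_ifs
    · exact (hpT i).1
    · exact hx
  · dsimp only
    rw [hr 0 (by omega)]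
    have : ((Finset.range (m + 2)).image fun i => if i ≤ m then p i else x).filter (G.Adj (p 0)) =
        {x, p 1} := by
      ext v
      simp only [Finset.mem_filter, Finset.mem_image, Finset.mem_range, Finset.mem_insert,
        Finset.mem_singleton]
      constructor
      · rintro ⟨⟨i, hi, rfl⟩, hadj⟩
        split_ifs at hadj ⊢ with h1
        · have h2 := hpind 0 (by omega) i h1 hadj
          have h3 : i ≠ 0 := by
            rintro rfl
            exact G.loopless.irrefl _ hadj
          right
          rw [show i = 1 by omega]
        · exact Or.inl rfl
      · rintro (rfl | rfl)
        · exact ⟨⟨m + 1, by omega, hrx⟩, hp0 ▸ hyx⟩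
        · exact ⟨⟨1, by omega, hr 1 (by omega)⟩, hpadj 0 (by omega)⟩
    rw [degOn, this, Finset.card_pair (hpx 1).symm]

end Cycles
section Ears

open scoped Classical

variable {V Y : Type*}

/-- An injective path `q 0, …, q k` in `B \ C` whose ends are attached to different vertices
`a` and `b` of `C`. -/
def IsEar (G : SimpleGraph V) (B C : Set V) (k : ℕ) (q : ℕ → V) (a b : V) : Prop :=
  a ∈ C ∧ b ∈ C ∧ a ≠ b ∧ (∀ i ≤ k, q i ∈ B \ C) ∧
    (∀ i ≤ k, ∀ j ≤ k, q i = q j → i = j) ∧ (∀ i < k, G.Adj (q i) (q (i + 1))) ∧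
    G.Adj a (q 0) ∧ G.Adj b (q k)

lemma IsEar.take {G : SimpleGraph V} {B C : Set V} {k : ℕ} {q : ℕ → V} {a b c : V}
    (h : IsEar G B C k q a b) {i : ℕ} (hi : i ≤ k) (hc : c ∈ C) (hac : a ≠ c)
    (hci : G.Adj c (q i)) : IsEar G B C i q a c := by
  obtain ⟨ha, hb, hab, hq, hinj, hadj, h0, hk⟩ := h
  exact ⟨ha, hc, hac, fun j hj => hq j (hj.trans hi),
    fun j hj l hl => hinj j (hj.trans hi) l (hl.trans hi),
    fun j hj => hadj j (lt_of_lt_of_le hj hi), h0, hci⟩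

lemma IsEar.drop {G : SimpleGraph V} {B C : Set V} {k : ℕ} {q : ℕ → V} {a b c : V}
    (h : IsEar G B C k q a b) {i : ℕ} (hi : i ≤ k) (hc : c ∈ C) (hcb : c ≠ b)
    (hci : G.Adj c (q i)) : IsEar G B C (k - i) (fun j => q (i + j)) c b := by
  obtain ⟨ha, hb, hab, hq, hinj, hadj, h0, hk⟩ := h
  refine ⟨hc, hb, hcb, fun j hj => hq _ (by omega), fun j hj l hl hjl => ?_,
    fun j hj => hadj (i + j) (by omega), hci, ?_⟩
  · have := hinj _ (by omega) _ (by omega) hjl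
    omega
  · dsimp only
    rwa [Nat.add_sub_cancel' hi]

lemma exists_isEar {G : SimpleGraph V} {B C : Set V} (hB : PBiconn G B) (hCB : C ⊆ B)
    (hne : C ≠ B) (hC : C.Nontrivial) : ∃ k q a b, IsEar G B C k q a b := by
  obtain ⟨a₀, ha₀, -⟩ := id hC
  obtain ⟨w₀, hw₀B, hw₀C⟩ := Set.exists_of_ssubset (hCB.ssubset_of_ne hne)
  obtain ⟨a, haB, w, hwB, haw, haC, hwC⟩ := hB.1.exists_boundary (P := fun v => v ∈ C)
    (hCB ha₀) hw₀B ha₀ hw₀C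
  obtain ⟨b, hbC, hba⟩ := hC.exists_ne a
  have hw : w ∈ B \ C := ⟨hwB, hwC⟩
  obtain ⟨u, hu, v, hv, huv, ⟨hu', hreach⟩, hPv⟩ := (hB.2 a haB).exists_boundary
    (P := fun v => ∃ hv : v ∈ B \ C, (G.induce (B \ C)).Reachable ⟨w, hw⟩ ⟨v, hv⟩)
    ⟨hwB, haw.ne'⟩ ⟨hCB hbC, hba⟩ ⟨hw, SimpleGraph.Reachable.refl _⟩ fun ⟨h, _⟩ => h.2 hbC
  have hvC : v ∈ C := by
    by_contra hvC
    have hadj : (G.induce (B \ C)).Adj ⟨u, hu'⟩ ⟨v, hv.1, hvC⟩ := huv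
    exact hPv ⟨⟨hv.1, hvC⟩, hreach.trans hadj.reachable⟩
  obtain ⟨k, q, hq0, hqk, hqT, hqadj, hqinj, -⟩ := exists_induced_path hreach
  dsimp only at hq0 hqk
  refine ⟨k, q, a, v, haC, hvC, fun h => hv.2 h.symm, fun i _ => hqT i, hqinj, hqadj, ?_, ?_⟩
  · rwa [hq0]
  · rw [hqk]
    exact huv.symm

lemma exists_choosable_of_ear {G : SimpleGraph V} {C : Finset V} (hC : PBiconn G (C : Set V))
    (hcard : 4 ≤ C.card) (hdeg : ∀ v ∈ C, degOn G C v = 2) {B : Set V}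
    (hear : ∃ k q a b, IsEar G B C k q a b) :
    ∃ S : Finset V, S.Nonempty ∧ ExcessChoosable Y G 0 S := by
  obtain ⟨q, a, b, hq⟩ := Nat.find_spec hear
  have hmin : ∀ k' q' a' b', IsEar G B C k' q' a' b' → Nat.find hear ≤ k' :=
    fun k' q' a' b' h => Nat.find_min' hear ⟨q', a', b', h⟩
  set k := Nat.find hear
  obtain ⟨haC, hbC, hab, hqC, hinj, hadj, h0, hk⟩ := id hq
  have haC' : a ∈ C := haC
  have hbC' : b ∈ C := hbC
  set D : Finset V := C ∪ (Finset.range (k + 1)).image q with hD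
  have hDbi : PBiconn G (D : Set V) := by
    convert hC.ear haC hbC hab (fun i hi => (hqC i hi).2) hinj hadj h0 hk using 1
    ext v
    simp [hD]
  have hCD : C ⊆ D := Finset.subset_union_left
  have hqD : ∀ i ≤ k, q i ∈ D := fun i hi =>
    Finset.mem_union_right _ (Finset.mem_image_of_mem q (Finset.mem_range.2 (by omega)))
  have hdega : 3 ≤ degOn G D a := by
    have hsub : insert (q 0) (C.filter (G.Adj a)) ⊆ D.filter (G.Adj a) := by
      intro v hv
      rcases Finset.mem_insert.1 hv with rfl | hv
      · exact Finset.mem_filter.2 ⟨hqD 0 (Nat.zero_le _), h0⟩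
      · rw [Finset.mem_filter] at hv ⊢
        exact ⟨hCD hv.1, hv.2⟩
    have hcardle := Finset.card_le_card hsub
    rw [Finset.card_insert_of_notMem fun h =>
      (hqC 0 (Nat.zero_le _)).2 (Finset.mem_filter.1 h).1] at hcardle
    have := hdeg a haC'
    unfold degOn at this ⊢
    omega
  by_cases hex : ∃ c ∈ C, ∀ i ≤ k, ¬ G.Adj c (q i)
  · obtain ⟨c, hcC, hc⟩ := hex
    refine ⟨D, ⟨a, hCD haC'⟩, choosable_of_degOn_ne hDbi (hCD haC') (hCD hcC) ?_⟩
    have : degOn G D c = 2 := by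
      rw [← hdeg c hcC]
      unfold degOn
      congr 1
      ext v
      simp only [Finset.mem_filter, and_congr_left_iff, hD, Finset.mem_union, Finset.mem_image,
        Finset.mem_range]
      intro hcv
      refine ⟨?_, Or.inl⟩
      rintro (h | ⟨i, hi, rfl⟩)
      · exact h
      · exact absurd hcv (hc i (by omega))
    omega
  · push Not at hex
    have hk0 : k = 0 := by
      obtain ⟨c, hcC, hca, hcb⟩ : ∃ c ∈ C, c ≠ a ∧ c ≠ b := by
        have : (({a, b} : Finset V)).card < C.card := by
          rw [Finset.card_pair hab]
          omega
        obtain ⟨c, hc, hc'⟩ := Finset.exists_mem_notMem_of_card_lt_card this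
        simp only [Finset.mem_insert, Finset.mem_singleton, not_or] at hc'
        exact ⟨c, hc, hc'⟩
      obtain ⟨i, hi, hci⟩ := hex c hcC
      have h1 := hmin _ _ _ _ (hq.take hi hcC hca.symm hci)
      have h2 := hmin _ _ _ _ (hq.drop hi hcC hcb hci)
      omega
    have hall : ∀ c ∈ C, G.Adj c (q 0) := fun c hc => by
      obtain ⟨i, hi, hci⟩ := hex c hc
      rwa [show i = 0 by omega] at hci
    refine ⟨D, ⟨a, hCD haC'⟩, choosable_of_degOn_ne hDbi (hCD haC') (hqD 0 (Nat.zero_le _)) ?_⟩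
    have h4 : 4 ≤ degOn G D (q 0) := hcard.trans <| Finset.card_le_card fun c hc =>
      Finset.mem_filter.2 ⟨hCD hc, (hall c hc).symm⟩
    have h3 : degOn G D a ≤ 3 := by
      have hsub : D.filter (G.Adj a) ⊆ insert (q 0) (C.filter (G.Adj a)) := by
        intro v hv
        obtain ⟨hvD, hav⟩ := Finset.mem_filter.1 hv
        rcases Finset.mem_union.1 hvD with h | h
        · exact Finset.mem_insert_of_mem (Finset.mem_filter.2 ⟨h, hav⟩)
        · obtain ⟨i, hi, rfl⟩ := Finset.mem_image.1 h
          rw [Finset.mem_range] at hi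
          rw [show i = 0 by omega]
          exact Finset.mem_insert_self _ _
      have h5 := (Finset.card_le_card hsub).trans (Finset.card_insert_le _ _)
      have := hdeg a haC'
      unfold degOn at this ⊢
      omega
    omega

/-- A biconnected set that is neither a clique nor an odd cycle yields a finite
degree-choosable set. -/
lemma exists_choosable_of_pBiconn {G : SimpleGraph V} {B : Set V} (hB : PBiconn G B)
    (hcl : ¬ G.IsClique B) (hodd : ¬ OddCycleSet G B) :
    ∃ S : Finset V, S.Nonempty ∧ ExcessChoosable Y G 0 S := by
  obtain ⟨n, r, hn, hcyc, hrB, hdeg0⟩ := exists_isCyc hB hcl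
  have hbi := hcyc.pBiconn (by omega)
  have h0 : r 0 ∈ (Finset.range n).image r :=
    Finset.mem_image_of_mem r (Finset.mem_range.2 (by omega))
  by_cases hdeg : ∀ v ∈ (Finset.range n).image r, degOn G ((Finset.range n).image r) v = 2
  · rcases Nat.even_or_odd n with he | ho
    · exact ⟨_, ⟨_, h0⟩, hcyc.choosable_of_even (by omega) hdeg he⟩
    · have hcard : ((Finset.range n).image r).card = n := by
        rw [Finset.card_image_of_injOn, Finset.card_range]
        intro i hi j hj hij
        exact hcyc.1 i (by simpa using hi) j (by simpa using hj) hij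
      have hCB : (((Finset.range n).image r : Finset V) : Set V) ⊆ B := by
        intro v hv
        obtain ⟨i, hi, rfl⟩ := Finset.mem_image.1 (Finset.mem_coe.1 hv)
        exact hrB i (Finset.mem_range.1 hi)
      refine exists_choosable_of_ear hbi (by omega) hdeg (exists_isEar hB hCB ?_ ?_)
      · intro h
        exact hodd (h ▸ hcyc.oddCycleSet (by omega) hdeg ho)
      · exact Finset.one_lt_card_iff_nontrivial.1 (by omega)
  · push Not at hdeg
    obtain ⟨v, hv, hne⟩ := hdeg
    exact ⟨_, ⟨_, h0⟩, choosable_of_degOn_ne hbi hv h0 (by rwa [hdeg0])⟩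

/-- A connected component that is not a Gallai tree contains a finite degree-choosable set. -/
lemma exists_choosable_of_not_gallaiTree (Y : Type*) {G : SimpleGraph V}
    {c : G.ConnectedComponent} (hc : ¬ GallaiTree (G.induce c.supp)) :
    ∃ S : Finset V, S.Nonempty ∧ (∀ v ∈ S, v ∈ c.supp) ∧ ExcessChoosable Y G 0 S := by
  have hconn : (G.induce c.supp).Connected := c.maximal_connected_induce_supp.prop
  obtain ⟨B, hB, hcl, hodd⟩ : ∃ B, GraphBlock (G.induce c.supp) B ∧
      ¬ (G.induce c.supp).IsClique B ∧ ¬ OddCycleSet (G.induce c.supp) B := by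
    by_contra! hcon
    refine hc ⟨hconn, fun S hS => ?_⟩
    by_cases h : (G.induce c.supp).IsClique S
    · exact Or.inl h
    · exact Or.inr (hcon S hS h)
  obtain ⟨S, hS, hch⟩ := exists_choosable_of_pBiconn (Y := Y)
    (B := B) ⟨pConn_iff.2 hB.1.1.preconnected, fun x hx => pConn_iff.2 (hB.1.2 x hx)⟩ hcl hodd
  obtain ⟨s, hs⟩ := hS
  refine ⟨S.image Subtype.val, ⟨s, Finset.mem_image_of_mem _ hs⟩, fun v hv => ?_,
    hch.of_iso Subtype.val (fun v => if h : v ∈ c.supp then ⟨v, h⟩ else s) ?_ ?_ ?_ ?_ ?_⟩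
  · obtain ⟨u, -, rfl⟩ := Finset.mem_image.1 hv
    exact u.2
  · exact fun v hv => Finset.mem_image_of_mem _ hv
  · intro v hv
    obtain ⟨u, hu, rfl⟩ := Finset.mem_image.1 hv
    simpa using hu
  · intro v _
    simp
  · intro v hv
    obtain ⟨u, hu, rfl⟩ := Finset.mem_image.1 hv
    simp
  · exact fun u _ v _ => Iff.rfl

end Ears

section Enumeration

variable {X Y Z : Type*}

lemma exists_measurable_enumeration [MeasurableSpace X] [StandardBorelSpace X]
    [MeasurableSpace Z] [StandardBorelSpace Z] (Φ : X → Finset Z)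
    (hΦ : MeasurableSet {p : X × Z | p.2 ∈ Φ p.1}) (hcard : Measurable fun x => (Φ x).card)
    (d : X → Z) (hd : Measurable d) :
    ∃ N : ℕ → X → Z, (∀ i, Measurable (N i)) ∧
      (∀ x z, z ∈ Φ x ↔ ∃ i < (Φ x).card, N i x = z) ∧
      ∀ i x, (Φ x).card ≤ i → N i x = d x := by
  classical
  obtain ⟨e, he⟩ := MeasureTheory.exists_measurableEmbedding_real Z
  let _ : LinearOrder Z := LinearOrder.lift' e he.injective
  have hmono : ∀ {n : ℕ} (y : Fin n → Z), StrictMono (fun j => e (y j)) ↔ StrictMono y :=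
    fun y => Iff.rfl
  refine ⟨fun i x => if h : i < (Φ x).card then (Φ x).orderEmbOfFin rfl ⟨i, h⟩ else d x,
    fun i U hU => ?_, fun x z => ⟨fun hz => ?_, ?_⟩, fun i x h => dif_neg (not_lt.2 h)⟩
  · let T : ∀ n, i < n → Set (X × (Fin n → Z)) := fun n h =>
      {p | (Φ p.1).card = n ∧ (∀ j, p.2 j ∈ Φ p.1) ∧ StrictMono (fun j => e (p.2 j)) ∧
        p.2 ⟨i, h⟩ ∈ U}
    have hT : ∀ n h, MeasurableSet (T n h) := by
      intro n h
      have h1 : MeasurableSet {p : X × (Fin n → Z) | (Φ p.1).card = n} :=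
        (hcard.comp measurable_fst) (measurableSet_singleton n)
      have h2 : MeasurableSet {p : X × (Fin n → Z) | ∀ j, p.2 j ∈ Φ p.1} := by
        have : {p : X × (Fin n → Z) | ∀ j, p.2 j ∈ Φ p.1} =
            ⋂ j, (fun p : X × (Fin n → Z) => (p.1, p.2 j)) ⁻¹' {p : X × Z | p.2 ∈ Φ p.1} := by
          ext p; simp
        rw [this]
        exact MeasurableSet.iInter fun j =>
          (measurable_fst.prodMk ((measurable_pi_apply j).comp measurable_snd)) hΦ
      have h3 : MeasurableSet {p : X × (Fin n → Z) | StrictMono (fun j => e (p.2 j))} := by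
        have : {p : X × (Fin n → Z) | StrictMono (fun j => e (p.2 j))} =
            ⋂ j, ⋂ k, ⋂ (_ : j < k), {p : X × (Fin n → Z) | e (p.2 j) < e (p.2 k)} := by
          ext p; simp [StrictMono]
        rw [this]
        exact MeasurableSet.iInter fun j => MeasurableSet.iInter fun k =>
          MeasurableSet.iInter fun _ => measurableSet_lt
            (he.measurable.comp ((measurable_pi_apply j).comp measurable_snd))
            (he.measurable.comp ((measurable_pi_apply k).comp measurable_snd))
      have h4 : MeasurableSet {p : X × (Fin n → Z) | p.2 ⟨i, h⟩ ∈ U} :=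
        ((measurable_pi_apply _).comp measurable_snd) hU
      exact h1.inter (h2.inter (h3.inter h4))
    have hinj : ∀ n h, Set.InjOn Prod.fst (T n h) := by
      rintro n h ⟨x, y⟩ ⟨hn, hy, hm, -⟩ ⟨x', y'⟩ ⟨-, hy', hm', -⟩ (rfl : x = x')
      have := Finset.orderEmbOfFin_unique hn hy ((hmono y).1 hm)
      have h' := Finset.orderEmbOfFin_unique hn hy' ((hmono y').1 hm')
      exact Prod.ext rfl (this.trans h'.symm)
    have heq : (fun x => if h : i < (Φ x).card then (Φ x).orderEmbOfFin rfl ⟨i, h⟩ else d x) ⁻¹' U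
        = ({x | (Φ x).card ≤ i} ∩ d ⁻¹' U) ∪ ⋃ n, ⋃ h : i < n, Prod.fst '' T n h := by
      ext x
      simp only [Set.mem_preimage, Set.mem_union, Set.mem_inter_iff, Set.mem_iUnion,
        Set.mem_image, Prod.exists]
      by_cases h : i < (Φ x).card
      · rw [dif_pos h]
        constructor
        · intro hx
          exact Or.inr ⟨_, h, x, (Φ x).orderEmbOfFin rfl, ⟨rfl, fun j =>
            Finset.orderEmbOfFin_mem _ _ _, (hmono _).2 (OrderEmbedding.strictMono _), hx⟩, rfl⟩
        · rintro (⟨hle, -⟩ | ⟨n, hn, x', y, ⟨hc, hy, hm, hu⟩, rfl⟩)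
          · exact absurd h (not_lt.2 hle)
          · dsimp only at hc hy hm hu
            subst hc
            rw [Finset.orderEmbOfFin_unique rfl hy ((hmono y).1 hm)] at hu
            exact hu
      · rw [dif_neg h]
        constructor
        · exact fun hx => Or.inl ⟨not_lt.1 h, hx⟩
        · rintro (⟨-, hx⟩ | ⟨n, hn, x', y, ⟨hc, hy, hm, hu⟩, rfl⟩)
          · exact hx
          · exact absurd (hc ▸ hn) h
    rw [heq]
    exact ((hcard measurableSet_Iic).inter (hd hU)).union
      (MeasurableSet.iUnion fun n => MeasurableSet.iUnion fun h =>
        (hT n h).image_of_measurable_injOn measurable_fst (hinj n h))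
  · have : z ∈ Set.range ((Φ x).orderEmbOfFin rfl) := by
      rw [Finset.range_orderEmbOfFin]; exact hz
    obtain ⟨j, hj⟩ := this
    exact ⟨j, j.2, (dif_pos j.2).trans hj⟩
  · rintro ⟨i, hi, rfl⟩
    dsimp only
    rw [dif_pos hi]
    exact Finset.orderEmbOfFin_mem _ _ _

lemma measurable_card_of_hits [MeasurableSpace X] [TopologicalSpace Y]
    [SecondCountableTopology Y] [T2Space Y] {L : X → Finset Y}
    (hL : ∀ U : Set Y, IsOpen U → MeasurableSet {x | ∃ y ∈ L x, y ∈ U}) :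
    Measurable fun x => (L x).card := by
  classical
  let B := TopologicalSpace.countableBasis Y
  have hB : TopologicalSpace.IsTopologicalBasis B := TopologicalSpace.isBasis_countableBasis Y
  have : Countable B := (TopologicalSpace.countable_countableBasis Y).to_subtype
  refine measurable_of_Ici fun n => ?_
  have : (fun x => (L x).card) ⁻¹' Set.Ici n =
      ⋃ U : Fin n → B, ⋃ _ : Pairwise fun i j => Disjoint (U i : Set Y) (U j),
        ⋂ i, {x | ∃ y ∈ L x, y ∈ (U i : Set Y)} := by
    ext x
    simp only [Set.mem_preimage, Set.mem_Ici, Set.mem_iUnion, Set.mem_iInter, Set.mem_ofPred,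
      exists_prop]
    constructor
    · intro hn
      obtain ⟨V, hV, hd⟩ := (L x).finite_toSet.t2_separation
      have : ∀ y : Y, ∃ U : B, y ∈ (U : Set Y) ∧ (U : Set Y) ⊆ V y := fun y => by
        obtain ⟨U, hU, hy, hs⟩ := hB.exists_subset_of_mem_open (hV y).1 (hV y).2
        exact ⟨⟨U, hU⟩, hy, hs⟩
      choose U hU hUV using this
      obtain ⟨T, hT, hTc⟩ := Finset.exists_subset_card_eq hn
      let g := T.equivFinOfCardEq hTc
      refine ⟨fun i => U (g.symm i), fun i j hij => ?_, fun i =>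
        ⟨g.symm i, hT (g.symm i).2, hU _⟩⟩
      refine (hd (hT (g.symm i).2) (hT (g.symm j).2) ?_).mono (hUV _) (hUV _)
      exact fun h => hij (g.symm.injective (Subtype.ext h))
    · rintro ⟨U, hU, h⟩
      choose y hy hyU using h
      have hinj : Function.Injective y := by
        intro i j hij
        by_contra hne
        exact Set.disjoint_left.1 (hU hne) (hyU i) (hij ▸ hyU j)
      calc n = (Finset.univ.image y).card := by
            rw [Finset.card_image_of_injective _ hinj, Finset.card_univ, Fintype.card_fin]
        _ ≤ _ := Finset.card_le_card (by
            intro z hz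
            obtain ⟨i, -, rfl⟩ := Finset.mem_image.1 hz
            exact hy i)
  rw [this]
  exact MeasurableSet.iUnion fun U => MeasurableSet.iUnion fun _ =>
    MeasurableSet.iInter fun i => hL _ (hB.isOpen (U i).2)

lemma measurableSet_mem_of_hits [MeasurableSpace X] [TopologicalSpace Y] [MeasurableSpace Y]
    [OpensMeasurableSpace Y] [SecondCountableTopology Y] [T2Space Y] {L : X → Finset Y}
    (hL : ∀ U : Set Y, IsOpen U → MeasurableSet {x | ∃ y ∈ L x, y ∈ U}) :
    MeasurableSet {p : X × Y | p.2 ∈ L p.1} := by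
  let B := TopologicalSpace.countableBasis Y
  have hB : TopologicalSpace.IsTopologicalBasis B := TopologicalSpace.isBasis_countableBasis Y
  have : Countable B := (TopologicalSpace.countable_countableBasis Y).to_subtype
  have : {p : X × Y | p.2 ∈ L p.1}ᶜ =
      ⋃ U : B, {x | ∃ y ∈ L x, y ∈ (U : Set Y)}ᶜ ×ˢ (U : Set Y) := by
    ext ⟨x, y⟩
    simp only [Set.mem_compl_iff, Set.mem_ofPred, Set.mem_iUnion, Set.mem_prod]
    constructor
    · intro hy
      obtain ⟨U, hU, hyU, hs⟩ := hB.exists_subset_of_mem_open (u := (↑(L x) : Set Y)ᶜ)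
        (by simpa using hy) (L x).finite_toSet.isClosed.isOpen_compl
      refine ⟨⟨U, hU⟩, ?_, hyU⟩
      rintro ⟨z, hz, hzU⟩
      exact hs hzU hz
    · rintro ⟨U, hU, hyU⟩ hy
      exact hU ⟨y, hy, hyU⟩
  rw [← MeasurableSet.compl_iff, this]
  exact MeasurableSet.iUnion fun U =>
    (hL _ (hB.isOpen U.2)).compl.prod (hB.isOpen U.2).measurableSet

end Enumeration

section Dynamics

open scoped Classical

variable {X Z : Type*}

/-- Follow the moves listed in a word. -/
def walk (N : ℕ → X → X) : List ℕ → X → X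
  | [], x => x
  | i :: s, x => walk N s (N i x)

lemma walk_append {N : ℕ → X → X} (s t : List ℕ) (x : X) : walk N (s ++ t) x = walk N t (walk N s x) := by
  induction s generalizing x with
  | nil => rfl
  | cons i s ih => exact ih _

variable [MeasurableSpace X]

lemma measurable_sInf_setOf {p : X → ℕ → Prop} (hp : ∀ n, Measurable fun x => p x n) :
    Measurable fun x => sInf {n | p x n} := by
  refine measurable_to_countable' fun n => ?_
  have : (fun x => sInf {n | p x n}) ⁻¹' {n} =
      {x | (p x n ∧ ∀ m < n, ¬ p x m) ∨ (n = 0 ∧ ∀ m, ¬ p x m)} := by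
    ext x
    simp only [Set.mem_preimage, Set.mem_singleton_iff, Set.mem_ofPred_eq]
    constructor
    · rintro rfl
      by_cases h : ∃ m, p x m
      · exact Or.inl ⟨Nat.sInf_mem h, fun m hm => Nat.notMem_of_lt_sInf hm⟩
      · push Not at h
        exact Or.inr ⟨by simp [h], h⟩
    · rintro (⟨h, hlt⟩ | ⟨rfl, h⟩)
      · refine le_antisymm (Nat.sInf_le h) (not_lt.1 fun hl => hlt _ hl (Nat.sInf_mem ⟨n, h⟩))
      · simp [h]
  rw [this]
  exact measurableSet_setOfPred.2 (((hp n).and (Measurable.forall fun m =>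
    Measurable.imp measurable_const (hp m).not)).or
      (measurable_const.and (Measurable.forall fun m => (hp m).not)))

lemma measurable_apply_index [MeasurableSpace Z] {N : ℕ → X → Z} (hN : ∀ i, Measurable (N i))
    {j : X → ℕ} (hj : Measurable j) : Measurable fun x => N (j x) x := by
  have : Measurable fun p : ℕ × X => N p.1 p.2 := measurable_from_prod_countable_right hN
  exact this.comp (hj.prodMk measurable_id)

lemma measurable_eq_prop [MeasurableSpace Z] [StandardBorelSpace Z] {f g : X → Z}
    (hf : Measurable f) (hg : Measurable g) : Measurable fun x => f x = g x :=
  measurableSet_setOfPred.1 (measurableSet_eq_fun hf hg)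

/-- A Borel enumeration `N` of the closed neighbourhoods of a locally finite Borel graph. -/
structure NeighborEnumeration (G : SimpleGraph X) (N : ℕ → X → X) : Prop where
  measurable : ∀ i, Measurable (N i)
  exists_iff : ∀ x y, (∃ i, N i x = y) ↔ y = x ∨ G.Adj x y
  finite : ∀ x, (G.neighborSet x).Finite

variable {G : SimpleGraph X} {N : ℕ → X → X}

namespace NeighborEnumeration

lemma measurable_walk (h : NeighborEnumeration G N) (s : List ℕ) : Measurable (walk N s) := by
  induction s with
  | nil => exact measurable_id
  | cons i s ih => exact ih.comp (h.measurable i)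

lemma adj_of_ne (h : NeighborEnumeration G N) {i : ℕ} {x : X} (hx : N i x ≠ x) :
    G.Adj x (N i x) :=
  ((h.exists_iff x (N i x)).1 ⟨i, rfl⟩).resolve_left hx

lemma exists_of_adj (h : NeighborEnumeration G N) {x y : X} (hxy : G.Adj x y) :
    ∃ i, N i x = y :=
  (h.exists_iff x y).2 (Or.inr hxy)

lemma reachable_walk (h : NeighborEnumeration G N) (s : List ℕ) (x : X) :
    G.Reachable x (walk N s x) := by
  induction s generalizing x with
  | nil => exact SimpleGraph.Reachable.refl _
  | cons i s ih =>
    refine SimpleGraph.Reachable.trans ?_ (ih _)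
    by_cases hx : N i x = x
    · rw [hx]
    · exact (h.adj_of_ne hx).reachable

lemma exists_walk (h : NeighborEnumeration G N) {x y : X} (hxy : G.Reachable x y) :
    ∃ s, walk N s x = y := by
  obtain ⟨p⟩ := hxy
  induction p with
  | nil => exact ⟨[], rfl⟩
  | cons hadj p ih =>
    obtain ⟨i, rfl⟩ := h.exists_of_adj hadj
    obtain ⟨s, hs⟩ := ih
    exact ⟨i :: s, hs⟩

lemma finite_walk_eq (h : NeighborEnumeration G N) (s : List ℕ) (y : X) :
    {x | walk N s x = y}.Finite := by
  induction s with
  | nil => simp [walk]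
  | cons i s ih =>
    refine (ih.biUnion fun w _ => (h.finite w).insert w).subset fun x hx => ?_
    refine Set.mem_biUnion (x := N i x) hx ?_
    by_cases hx : N i x = x
    · exact Or.inl hx.symm
    · exact Or.inr (h.adj_of_ne hx).symm

lemma measurable_comp_walk (h : NeighborEnumeration G N) {P : X → Prop} (hP : Measurable P)
    (s : List ℕ) : Measurable fun x => P (walk N s x) :=
  hP.comp (h.measurable_walk s)

variable [StandardBorelSpace X]

lemma measurable_adj (h : NeighborEnumeration G N) {f g : X → X} (hf : Measurable f)
    (hg : Measurable g) : Measurable fun x => G.Adj (f x) (g x) := by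
  have : (fun x => G.Adj (f x) (g x)) = fun x => g x ≠ f x ∧ ∃ i, N i (f x) = g x := by
    ext x
    rw [h.exists_iff]
    constructor
    · exact fun ha => ⟨ha.ne', Or.inr ha⟩
    · exact fun ha => ha.2.resolve_left ha.1
  rw [this]
  exact (measurable_eq_prop hg hf).not.and (Measurable.exists fun i =>
    measurable_eq_prop ((h.measurable i).comp hf) hg)

/-- A set meeting every component carries a Borel rank with values in a countable well-order
along which every vertex off the set has a larger neighbour. -/
lemma exists_rank (h : NeighborEnumeration G N) {κ : X → ℕ} (hκ : Measurable κ)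
    (hκG : ∀ x y, G.Adj x y → κ x ≠ κ y) {A : Set X} (hA : MeasurableSet A)
    (hmeet : ∀ x, ∃ s, walk N s x ∈ A) :
    ∃ ρ : X → ℕ ×ₗ ℕ ×ₗ ℕ, (∀ p, MeasurableSet {x | ρ x = p}) ∧
      (∀ x, x ∉ A → ∃ y, G.Adj x y ∧ ρ x < ρ y) ∧
      ∀ x y, G.Adj x y → ρ x ≠ ρ y := by
  have hAm : Measurable fun x => x ∈ A := measurableSet_setOfPred.1 hA
  let d : X → ℕ := fun x => sInf {n | ∃ s : List ℕ, s.length = n ∧ walk N s x ∈ A}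
  have hd : Measurable d := measurable_sInf_setOf fun n => Measurable.exists fun s =>
    measurable_const.and (h.measurable_comp_walk hAm s)
  have hdmem : ∀ x, ∃ s : List ℕ, s.length = d x ∧ walk N s x ∈ A := fun x =>
    Nat.sInf_mem (s := {n | ∃ s : List ℕ, s.length = n ∧ walk N s x ∈ A})
      (let ⟨s, hs⟩ := hmeet x; ⟨_, s, rfl, hs⟩)
  have hdle : ∀ x s, walk N s x ∈ A → d x ≤ s.length := fun x s hs =>
    Nat.sInf_le ⟨s, rfl, hs⟩
  have hstep : ∀ x, x ∉ A → ∃ i, d (N i x) < d x := by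
    intro x hx
    obtain ⟨s, hs, hsA⟩ := hdmem x
    cases s with
    | nil => exact absurd hsA hx
    | cons i s =>
      refine ⟨i, ?_⟩
      have := hdle (N i x) s hsA
      rw [← hs, List.length_cons]
      omega
  let j : X → ℕ := fun x => sInf {i | d (N i x) < d x}
  have hltm : ∀ f g : X → ℕ, Measurable f → Measurable g → Measurable fun x => f x < g x :=
    fun f g hf hg => measurableSet_setOfPred.1 (measurableSet_lt hf hg)
  have hj : Measurable j := measurable_sInf_setOf fun i => hltm _ _ (hd.comp (h.measurable i)) hd
  let f : X → X := fun x => N (j x) x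
  have hf : Measurable f := measurable_apply_index h.measurable hj
  have hfd : ∀ x, x ∉ A → d (f x) < d x := fun x hx =>
    Nat.sInf_mem (s := {i | d (N i x) < d x}) (hstep x hx)
  have hfadj : ∀ x, x ∉ A → G.Adj x (f x) := fun x hx =>
    h.adj_of_ne fun he => (hfd x hx).ne (congrArg d he)
  obtain ⟨C, hCzero, hCsucc⟩ : ∃ C : ℕ → X → Prop, C 0 = (fun _ => True) ∧ ∀ n,
      C (n + 1) = fun x => ∃ i, (N i x ∉ A ∧ f (N i x) = x) ∧ C n (N i x) :=
    ⟨fun n => n.rec (fun _ => True) fun _ P x => ∃ i, (N i x ∉ A ∧ f (N i x) = x) ∧ P (N i x),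
      rfl, fun _ => rfl⟩
  have hC0 : ∀ x, C 0 x := fun x => by rw [hCzero]; trivial
  have hCs : ∀ n x, C (n + 1) x ↔ ∃ i, (N i x ∉ A ∧ f (N i x) = x) ∧ C n (N i x) :=
    fun n x => by rw [hCsucc]
  have hCm : ∀ n, Measurable (C n) := by
    intro n
    induction n with
    | zero => rw [hCzero]; exact measurable_const
    | succ n ih =>
      rw [hCsucc]
      exact Measurable.exists fun i => ((hAm.comp (h.measurable i)).not.and
        (measurable_eq_prop (hf.comp (h.measurable i)) measurable_id)).and (ih.comp (h.measurable i))
  have hCmono : ∀ n x, C (n + 1) x → C n x := by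
    intro n
    induction n with
    | zero => exact fun x _ => hC0 x
    | succ n ih =>
      intro x hx
      obtain ⟨i, hi, hi'⟩ := (hCs (n + 1) x).1 hx
      exact (hCs n x).2 ⟨i, hi, ih _ hi'⟩
  have hCanti : ∀ m n x, m ≤ n → C n x → C m x := by
    intro m n x hmn hn
    induction hmn with
    | refl => exact hn
    | step _ ih => exact ih (hCmono _ _ hn)
  have hCparent : ∀ n x, x ∉ A → C n x → C (n + 1) (f x) := by
    intro n x hx hn
    obtain ⟨i, hi⟩ := h.exists_of_adj (hfadj x hx).symm
    exact (hCs _ _).2 ⟨i, by rw [hi]; exact ⟨hx, rfl⟩, by rw [hi]; exact hn⟩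
  have hkonig : ∀ x, (∀ n, C n x) → ∃ c, c ∉ A ∧ f c = x ∧ ∀ n, C n c := by
    intro x hx
    by_contra hcon
    push Not at hcon
    have hfin : {c | c ∉ A ∧ f c = x}.Finite := (h.finite x).subset fun c hc => by
      have := hfadj c hc.1
      rw [hc.2] at this
      exact this.symm
    have : ∀ c, ∃ n, c ∉ A → f c = x → ¬ C n c := fun c => by
      by_cases hc : c ∉ A ∧ f c = x
      · obtain ⟨n, hn⟩ := hcon c hc.1 hc.2
        exact ⟨n, fun _ _ => hn⟩
      · exact ⟨0, fun h1 h2 => absurd ⟨h1, h2⟩ hc⟩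
    choose n hn using this
    obtain ⟨i, hi, hi'⟩ := (hCs _ _).1 (hx (hfin.toFinset.sup n + 1))
    refine hn _ hi.1 hi.2 (hCanti _ _ _ (Finset.le_sup (f := n) ?_) hi')
    exact hfin.mem_toFinset.2 hi
  let t : X → ℕ := fun x => if x ∈ A then 2 else if ∀ n, C n x then 1 else 0
  have hall : Measurable fun x => ∀ n, C n x := Measurable.forall hCm
  have hall' : MeasurableSet {x | ∀ n, C n x} := measurableSet_setOfPred.2 hall
  have ht : Measurable t := Measurable.ite hA measurable_const
    (Measurable.ite hall' measurable_const measurable_const)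
  let key : X → ℕ := fun x => if ∀ n, C n x then d x else sInf {n | ¬ C n x}
  have hkey : Measurable key := Measurable.ite hall' hd
    (measurable_sInf_setOf fun n => (hCm n).not)
  refine ⟨fun x => toLex (t x, toLex (key x, κ x)), fun p => ?_, fun x hx => ?_,
    fun x y hxy he => ?_⟩
  · have : {x | toLex (t x, toLex (key x, κ x)) = p} =
        t ⁻¹' {(ofLex p).1} ∩ (key ⁻¹' {(ofLex (ofLex p).2).1} ∩
          κ ⁻¹' {(ofLex (ofLex p).2).2}) := by
      ext x
      constructor
      · rintro rfl
        exact ⟨rfl, rfl, rfl⟩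
      · rintro ⟨h1, h2, h3⟩
        exact congrArg toLex (Prod.ext h1 (congrArg toLex (Prod.ext h2 h3)))
    rw [this]
    exact (ht (measurableSet_singleton _)).inter
      ((hkey (measurableSet_singleton _)).inter (hκ (measurableSet_singleton _)))
  · by_cases hx1 : ∀ n, C n x
    · obtain ⟨c, hc, hcx, hc1⟩ := hkonig x hx1
      refine ⟨c, ?_, ?_⟩
      · have := hfadj c hc
        rw [hcx] at this
        exact this.symm
      · refine Prod.Lex.lt_iff.2 (Or.inr ⟨?_, Prod.Lex.lt_iff.2 (Or.inl ?_)⟩)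
        · change t x = t c
          simp [t, hx, hc, hx1, hc1]
        · change key x < key c
          have := hfd c hc
          rw [hcx] at this
          simpa [key, hx1, hc1] using this
    · refine ⟨f x, hfadj x hx, ?_⟩
      have htx : t x = 0 := by simp only [t, if_neg hx, if_neg hx1]
      by_cases hy : f x ∈ A ∨ ∀ n, C n (f x)
      · refine Prod.Lex.lt_iff.2 (Or.inl ?_)
        change t x < t (f x)
        rw [htx]
        by_cases hy' : f x ∈ A
        · simp only [t, if_pos hy']; omega
        · simp only [t, if_neg hy', if_pos (hy.resolve_left hy')]; omega
      · push Not at hy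
        have hy2 : ¬ ∀ n, C n (f x) := by push Not; exact hy.2
        refine Prod.Lex.lt_iff.2 (Or.inr ⟨?_, Prod.Lex.lt_iff.2 (Or.inl ?_)⟩)
        · change t x = t (f x)
          rw [htx]
          simp only [t, if_neg hy.1, if_neg hy2]
        · change key x < key (f x)
          simp only [key, if_neg hx1, if_neg hy2]
          have hmem : ¬ C (sInf {n | ¬ C n (f x)}) (f x) :=
            Nat.sInf_mem (s := {n | ¬ C n (f x)}) hy.2
          generalize sInf {n | ¬ C n (f x)} = m at hmem ⊢
          cases m with
          | zero => exact absurd (hC0 _) hmem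
          | succ m =>
            have : sInf {n | ¬ C n x} ≤ m := Nat.sInf_le fun hm => hmem (hCparent m x hx hm)
            omega
  · have := congrArg (fun p => (ofLex (ofLex p).2).2) he
    exact hκG x y hxy this

end NeighborEnumeration

/-- Greedy colouring along a well-ordered rank is Borel. -/
lemma exists_greedy_index [MeasurableSpace Z] [StandardBorelSpace Z] {I : Type*} [LinearOrder I]
    [WellFoundedLT I] [Countable I] {ρ : X → I} (hρ : ∀ p, MeasurableSet {x | ρ x = p})
    (hN : ∀ i, Measurable (N i)) {l : ℕ → X → Z} (hl : ∀ i, Measurable (l i)) :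
    ∃ ind : X → ℕ, Measurable ind ∧ ∀ x, ind x =
      sInf {i | ∀ k, ρ (N k x) < ρ x → l i x ≠ l (ind (N k x)) (N k x)} := by
  have hwf : WellFounded (InvImage (· < ·) ρ) := InvImage.wf ρ wellFounded_lt
  let ind : X → ℕ := hwf.fix fun x F =>
    sInf {i | ∀ k, ∀ h : ρ (N k x) < ρ x, l i x ≠ l (F (N k x) h) (N k x)}
  have hind : ∀ x, ind x =
      sInf {i | ∀ k, ρ (N k x) < ρ x → l i x ≠ l (ind (N k x)) (N k x)} :=
    fun x => hwf.fix_eq _ x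
  refine ⟨ind, ?_, hind⟩
  have hρm : ∀ p, Measurable fun x => ρ x = p := fun p => measurableSet_setOfPred.1 (hρ p)
  have key : ∀ p i, Measurable fun x => ρ x = p ∧ ind x = i := by
    intro p
    induction p using WellFoundedLT.induction with
    | ind p ih =>
      intro i
      have hm : Measurable fun x => sInf {i | ∀ k, ∀ q : Set.Iio p, ∀ j,
          (ρ (N k x) = q ∧ ind (N k x) = j) → l i x ≠ l j (N k x)} :=
        measurable_sInf_setOf fun i => Measurable.forall fun k => Measurable.forall fun q =>
          Measurable.forall fun j => ((ih q q.2 j).comp (hN k)).imp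
            (measurable_eq_prop (hl i) ((hl j).comp (hN k))).not
      have : (fun x => ρ x = p ∧ ind x = i) = fun x => ρ x = p ∧ sInf {i | ∀ k,
          ∀ q : Set.Iio p, ∀ j, (ρ (N k x) = q ∧ ind (N k x) = j) →
            l i x ≠ l j (N k x)} = i := by
        ext x
        refine and_congr_right fun hx => ?_
        rw [hind x, hx]
        have : {i | ∀ k, ρ (N k x) < p → l i x ≠ l (ind (N k x)) (N k x)} = {i | ∀ k,
            ∀ q : Set.Iio p, ∀ j, (ρ (N k x) = q ∧ ind (N k x) = j) →
              l i x ≠ l j (N k x)} := by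
          ext i
          constructor
          · rintro hi k q j ⟨hq, rfl⟩
            exact hi k (hq ▸ q.2)
          · exact fun hi k hk => hi k ⟨_, hk⟩ _ ⟨rfl, rfl⟩
        rw [this]
      rw [this]
      exact (hρm p).and (measurable_eq_prop hm measurable_const)
  refine measurable_to_countable' fun i => ?_
  have : ind ⁻¹' {i} = ⋃ p, {x | ρ x = p ∧ ind x = i} := by ext x; simp
  rw [this]
  exact MeasurableSet.iUnion fun p => measurableSet_setOfPred.2 (key p i)

end Dynamics

section Pieces

open scoped Classical

variable {X Y : Type*}

/-- A greedy colour exists at every vertex with a neighbour of larger rank. -/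
lemma greedy_index_spec {G : SimpleGraph X} {N : ℕ → X → X} {I : Type*} [LinearOrder I]
    {ρ : X → I} {l : ℕ → X → Y} {L : X → Finset Y} {ind : X → ℕ} {x y : X}
    (hN : ∀ y, G.Adj x y → ∃ k, N k x = y) (hN' : ∀ k, N k x = x ∨ G.Adj x (N k x))
    (hfin : (G.neighborSet x).Finite) (hcard : (L x).card = (G.neighborSet x).ncard)
    (hl : ∀ z ∈ L x, ∃ i < (L x).card, l i x = z)
    (hind : ind x = sInf {i | ∀ k, ρ (N k x) < ρ x → l i x ≠ l (ind (N k x)) (N k x)})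
    (hy : G.Adj x y) (hxy : ρ x < ρ y) :
    ind x < (L x).card ∧
      ∀ z, G.Adj x z → ρ z < ρ x → l (ind x) x ≠ l (ind z) z := by
  let E := hfin.toFinset.filter fun z => ρ z < ρ x
  have hE : E.card < (L x).card := by
    rw [hcard, Set.ncard_eq_toFinset_card _ hfin]
    refine Finset.card_lt_card (Finset.filter_ssubset.2 ⟨y, ?_, hxy.not_gt⟩)
    simpa using hy
  obtain ⟨z, hz, hzE⟩ := Finset.exists_mem_notMem_of_card_lt_card
    (lt_of_le_of_lt (Finset.card_image_le (s := E) (f := fun z => l (ind z) z)) hE)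
  obtain ⟨i, hi, rfl⟩ := hl z hz
  have hmem : i ∈ {i | ∀ k, ρ (N k x) < ρ x → l i x ≠ l (ind (N k x)) (N k x)} := by
    intro k hk he
    refine hzE (Finset.mem_image.2 ⟨N k x, ?_, he.symm⟩)
    refine Finset.mem_filter.2 ⟨?_, hk⟩
    simpa using (hN' k).resolve_left fun h => hk.ne (congrArg ρ h)
  constructor
  · rw [hind]
    exact (Nat.sInf_le hmem).trans_lt hi
  · intro z hz hzx
    obtain ⟨k, rfl⟩ := hN z hz
    have := Nat.sInf_mem ⟨i, hmem⟩
    rw [← hind] at this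
    exact this k hzx

lemma exists_separating_sequence (X : Type*) [MeasurableSpace X] [StandardBorelSpace X] :
    ∃ b : ℕ → Set X, (∀ n, MeasurableSet (b n)) ∧
      ∀ (x : X) (F : Set X), F.Finite → x ∉ F → ∃ n, x ∈ b n ∧ ∀ y ∈ F, y ∉ b n := by
  let := upgradeStandardBorel X
  have hB := TopologicalSpace.isBasis_countableBasis X
  obtain ⟨b, hb⟩ := ((TopologicalSpace.countable_countableBasis X).insert ∅).exists_eq_range
    (Set.insert_nonempty _ _)
  refine ⟨b, fun n => ?_, fun x F hF hx => ?_⟩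
  · have : b n ∈ insert ∅ (TopologicalSpace.countableBasis X) := hb ▸ Set.mem_range_self n
    rcases this with h | h
    · rw [h]; exact MeasurableSet.empty
    · exact (hB.isOpen h).measurableSet
  · obtain ⟨U, hU, hxU, hs⟩ := hB.exists_subset_of_mem_open (u := Fᶜ) hx
      hF.isClosed.isOpen_compl
    have : U ∈ Set.range b := hb ▸ Set.mem_insert_of_mem _ hU
    obtain ⟨n, rfl⟩ := this
    exact ⟨n, hxU, fun y hy h => hs h hy⟩

/-- The finite set reached from `x` by the words in `J`. -/
noncomputable def piece (N : ℕ → X → X) (J : Finset (List ℕ)) (x : X) : Finset X :=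
  J.image fun s => walk N s x

lemma mem_piece {N : ℕ → X → X} {J : Finset (List ℕ)} {x y : X} :
    y ∈ piece N J x ↔ ∃ s ∈ J, walk N s x = y :=
  Finset.mem_image

lemma choosable_piece_of_pattern {G : SimpleGraph X} {N : ℕ → X → X} {J : Finset (List ℕ)}
    {x z : X} (h : ExcessChoosable Y G 0 (piece N J x))
    (heq : ∀ s ∈ J, ∀ t ∈ J, (walk N s x = walk N t x ↔ walk N s z = walk N t z))
    (hadj : ∀ s ∈ J, ∀ t ∈ J,
      (G.Adj (walk N s x) (walk N t x) ↔ G.Adj (walk N s z) (walk N t z))) :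
    ExcessChoosable Y G 0 (piece N J z) := by
  have hw : ∀ (x v : X), ∃ s, v ∈ piece N J x → s ∈ J ∧ walk N s x = v := fun x v => by
    by_cases hv : v ∈ piece N J x
    · obtain ⟨s, hs⟩ := mem_piece.1 hv
      exact ⟨s, fun _ => hs⟩
    · exact ⟨[], fun h => absurd h hv⟩
  choose w hw using hw
  refine h.of_iso (fun v => walk N (w x v) z) (fun v => walk N (w z v) x) (fun v hv => ?_)
    (fun v hv => ?_) (fun v hv => ?_) (fun v hv => ?_) fun u hu v hv => ?_
  · exact mem_piece.2 ⟨_, (hw x v hv).1, rfl⟩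
  · exact mem_piece.2 ⟨_, (hw z v hv).1, rfl⟩
  · have h2 := hw z (walk N (w x v) z) (mem_piece.2 ⟨_, (hw x v hv).1, rfl⟩)
    exact ((heq _ h2.1 _ (hw x v hv).1).2 h2.2).trans (hw x v hv).2
  · have h2 := hw x (walk N (w z v) x) (mem_piece.2 ⟨_, (hw z v hv).1, rfl⟩)
    exact ((heq _ h2.1 _ (hw z v hv).1).1 h2.2).trans (hw z v hv).2
  · rw [← hadj _ (hw x u hu).1 _ (hw x v hv).1, (hw x u hu).2, (hw x v hv).2]

namespace NeighborEnumeration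

variable [MeasurableSpace X] [StandardBorelSpace X] {G : SimpleGraph X} {N : ℕ → X → X}

lemma exists_coloring_nat (h : NeighborEnumeration G N) :
    ∃ κ : X → ℕ, Measurable κ ∧ ∀ x y, G.Adj x y → κ x ≠ κ y := by
  obtain ⟨b, hb, hsep⟩ := exists_separating_sequence X
  have hbm : ∀ n, Measurable fun x => x ∈ b n := fun n => measurableSet_setOfPred.1 (hb n)
  refine ⟨fun x => sInf {n | x ∈ b n ∧ ∀ i, N i x = x ∨ N i x ∉ b n},
    measurable_sInf_setOf fun n => (hbm n).and (Measurable.forall fun i =>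
      (measurable_eq_prop (h.measurable i) measurable_id).or
        ((hbm n).comp (h.measurable i)).not), fun x y hxy he => ?_⟩
  have key : ∀ x, sInf {n | x ∈ b n ∧ ∀ i, N i x = x ∨ N i x ∉ b n} ∈
      {n | x ∈ b n ∧ ∀ i, N i x = x ∨ N i x ∉ b n} := fun x => by
    obtain ⟨n, hn, hn'⟩ := hsep x (G.neighborSet x) (h.finite x) (by simp)
    refine Nat.sInf_mem ⟨n, hn, fun i => or_iff_not_imp_left.2 fun hi => ?_⟩
    exact hn' _ (h.adj_of_ne hi)
  have hx := key x
  have hy := key y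
  dsimp only at he
  rw [he] at hx
  obtain ⟨i, hi⟩ := h.exists_of_adj hxy
  rcases hx.2 i with h1 | h1
  · exact hxy.ne (h1.symm.trans hi)
  · rw [hi] at h1
    exact h1 hy.1

lemma measurable_choosable_piece (h : NeighborEnumeration G N) (Y : Type*)
    (J : Finset (List ℕ)) : Measurable fun x => ExcessChoosable Y G 0 (piece N J x) := by
  let pat : X → (J × J → Prop × Prop) := fun x p =>
    (walk N p.1 x = walk N p.2 x, G.Adj (walk N p.1 x) (walk N p.2 x))
  have hpat : Measurable pat := measurable_pi_lambda _ fun p =>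
    (measurable_eq_prop (h.measurable_walk p.1) (h.measurable_walk p.2)).prodMk
      (h.measurable_adj (h.measurable_walk p.1) (h.measurable_walk p.2))
  have : {x | ExcessChoosable Y G 0 (piece N J x)} =
      pat ⁻¹' (pat '' {x | ExcessChoosable Y G 0 (piece N J x)}) := by
    refine Set.Subset.antisymm (Set.subset_preimage_image _ _) ?_
    rintro z ⟨x, hx, hxz⟩
    refine choosable_piece_of_pattern hx (fun s hs t ht => ?_) fun s hs t ht => ?_
    · exact iff_of_eq (congrArg Prod.fst (congrFun hxz (⟨s, hs⟩, ⟨t, ht⟩)))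
    · exact iff_of_eq (congrArg Prod.snd (congrFun hxz (⟨s, hs⟩, ⟨t, ht⟩)))
  refine measurableSet_setOfPred.1 ?_
  rw [this]
  exact hpat (MeasurableSet.of_discrete)

/-- If no component is a Gallai tree, there is a Borel family of pairwise far apart choosable
pieces meeting every component. -/
lemma exists_pieces (h : NeighborEnumeration G N) (Y : Type*)
    (hG : ∀ c : G.ConnectedComponent, ¬ GallaiTree (G.induce c.supp)) :
    ∃ (D : Set X) (J : X → Finset (List ℕ)), MeasurableSet D ∧
      (∀ t, Measurable fun x => t ∈ J x) ∧ (∀ x, ∃ s, walk N s x ∈ D) ∧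
      (∀ x ∈ D, (J x).Nonempty ∧ ExcessChoosable Y G 0 (piece N (J x) x)) ∧
      ∀ x ∈ D, ∀ z ∈ D, ∀ s ∈ J x, ∀ t ∈ J z,
        walk N s x = walk N t z ∨ G.Adj (walk N s x) (walk N t z) → x = z := by
  obtain ⟨b, hb, hsep⟩ := exists_separating_sequence X
  have hbm : ∀ n, Measurable fun x => x ∈ b n := fun n => measurableSet_setOfPred.1 (hb n)
  obtain ⟨σ, hσ⟩ := exists_surjective_nat (Finset (List ℕ) × ℕ)
  let touch : Finset (List ℕ) → X → X → Prop := fun J x z => ∃ s ∈ J, ∃ t ∈ J,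
    walk N s x = walk N t z ∨ G.Adj (walk N s x) (walk N t z)
  let good : ℕ → X → Prop := fun k x => (σ k).1.Nonempty ∧
    ExcessChoosable Y G 0 (piece N (σ k).1 x) ∧ x ∈ b (σ k).2 ∧
      ∀ s, walk N s x = x ∨ walk N s x ∉ b (σ k).2 ∨ ¬ touch (σ k).1 x (walk N s x)
  have hgood : ∀ k, Measurable (good k) := fun k => by
    refine measurable_const.and ((h.measurable_choosable_piece Y _).and ((hbm _).and
      (Measurable.forall fun s => (measurable_eq_prop (h.measurable_walk s) measurable_id).or
        ((h.measurable_comp_walk (hbm _) s).not.or (Measurable.not ?_)))))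
    refine Measurable.exists fun u => measurable_const.and (Measurable.exists fun v =>
      measurable_const.and ?_)
    have hv := (h.measurable_walk v).comp (h.measurable_walk s)
    exact (measurable_eq_prop (h.measurable_walk u) hv).or
      (h.measurable_adj (h.measurable_walk u) hv)
  have hex : ∀ x, ∃ k, ∃ s, good k (walk N s x) := by
    intro x
    obtain ⟨S, ⟨v, hv⟩, hSc, hS⟩ := exists_choosable_of_not_gallaiTree Y
      (hG (G.connectedComponentMk x))
    have hreach : ∀ u ∈ S, G.Reachable x u := fun u hu =>
      (SimpleGraph.ConnectedComponent.exact (hSc u hu)).symm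
    have hword : ∀ u, ∃ s, u ∈ S → walk N s v = u := fun u => by
      by_cases hu : u ∈ S
      · obtain ⟨s, hs⟩ := h.exists_walk ((hreach v hv).symm.trans (hreach u hu))
        exact ⟨s, fun _ => hs⟩
      · exact ⟨[], fun h => absurd h hu⟩
    choose w hw using hword
    have hpiece : piece N (S.image w) v = S := by
      ext u
      rw [mem_piece]
      constructor
      · rintro ⟨s, hs, rfl⟩
        obtain ⟨u, hu, rfl⟩ := Finset.mem_image.1 hs
        rw [hw u hu]
        exact hu
      · exact fun hu => ⟨w u, Finset.mem_image_of_mem _ hu, hw u hu⟩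
    have hfin : {z | z ≠ v ∧ touch (S.image w) v z}.Finite := by
      have : (⋃ s ∈ S.image w, ⋃ t ∈ S.image w,
          ⋃ y ∈ insert (walk N s v) (G.neighborSet (walk N s v)),
            {z | walk N t z = y}).Finite :=
        (S.image w).finite_toSet.biUnion fun s _ => (S.image w).finite_toSet.biUnion fun t _ =>
          ((h.finite _).insert _).biUnion fun y _ => h.finite_walk_eq t y
      refine this.subset ?_
      rintro z ⟨-, s, hs, t, ht, hst⟩
      simp only [Set.mem_iUnion]
      refine ⟨s, hs, t, ht, walk N t z, ?_, rfl⟩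
      exact hst.imp Eq.symm id
    obtain ⟨n, hn, hn'⟩ := hsep v _ hfin (by simp)
    obtain ⟨k, hk⟩ := hσ (S.image w, n)
    obtain ⟨s, hs⟩ := h.exists_walk (hreach v hv)
    refine ⟨k, s, ?_⟩
    simp only [good, hk, hs, hpiece]
    refine ⟨⟨w v, Finset.mem_image_of_mem _ hv⟩, hS, hn, fun s => ?_⟩
    by_cases h1 : walk N s v = v
    · exact Or.inl h1
    · by_cases h2 : touch (S.image w) v (walk N s v)
      · exact Or.inr (Or.inl (hn' _ ⟨h1, h2⟩))
      · exact Or.inr (Or.inr h2)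
  let K : X → ℕ := fun x => sInf {k | ∃ s, good k (walk N s x)}
  have hK : Measurable K := measurable_sInf_setOf fun k => Measurable.exists fun s =>
    h.measurable_comp_walk (hgood k) s
  have hKinv : ∀ x z, G.Reachable x z → K x = K z := by
    have key : ∀ x z, G.Reachable x z → ∀ k, (∃ s, good k (walk N s x)) →
        ∃ s, good k (walk N s z) := by
      rintro x z hxz k ⟨s, hs⟩
      obtain ⟨t, ht⟩ := h.exists_walk (hxz.symm.trans (h.reachable_walk s x))
      exact ⟨t, ht ▸ hs⟩
    intro x z hxz
    have : {k | ∃ s, good k (walk N s x)} = {k | ∃ s, good k (walk N s z)} :=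
      Set.ext fun k => ⟨key x z hxz k, key z x hxz.symm k⟩
    exact congrArg sInf this
  have hKeq : ∀ k, Measurable fun x => K x = k := fun k =>
    measurable_eq_prop hK measurable_const
  refine ⟨{x | good (K x) x}, fun x => (σ (K x)).1, measurableSet_setOfPred.2 ?_, fun t => ?_,
    fun x => ?_, fun x hx => ⟨hx.1, hx.2.1⟩, fun x hx z hz s hs t ht hst => ?_⟩
  · have : (fun x => good (K x) x) = fun x => ∃ k, K x = k ∧ good k x := by ext x; simp
    rw [this]
    exact Measurable.exists fun k => (hKeq k).and (hgood k)
  · have : (fun x => t ∈ (σ (K x)).1) = fun x => ∃ k, K x = k ∧ t ∈ (σ k).1 := by ext x; simp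
    rw [this]
    exact Measurable.exists fun k => (hKeq k).and measurable_const
  · obtain ⟨s, hs⟩ := Nat.sInf_mem (s := {k | ∃ s, good k (walk N s x)}) (hex x)
    refine ⟨s, ?_⟩
    change good (K (walk N s x)) (walk N s x)
    rw [← hKinv _ _ (h.reachable_walk s x)]
    exact hs
  · have hxz : G.Reachable x z := by
      refine (h.reachable_walk s x).trans (SimpleGraph.Reachable.trans ?_
        (h.reachable_walk t z).symm)
      rcases hst with he | ha
      · rw [he]
      · exact ha.reachable
    have hx' : good (K x) x := hx
    have hz' : good (K z) z := hz
    dsimp only at ht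
    rw [← hKinv x z hxz] at hz' ht
    obtain ⟨u, rfl⟩ := h.exists_walk hxz
    rcases hx'.2.2.2 u with h1 | h1 | h1
    · exact h1.symm
    · exact absurd hz'.2.2.1 h1
    · exact absurd ⟨s, hs, t, ht, hst⟩ h1

end NeighborEnumeration

end Pieces

section Coloring

open scoped Classical

variable {X Y : Type*}

/-- A choosable set can be coloured compatibly with a colouring of the remaining vertices. -/
lemma exists_extension_of_choosable {G : SimpleGraph X} {S : Finset X} {A : Set X}
    {L : X → Finset Y} (hS : ExcessChoosable Y G 0 S) (hSA : ∀ x ∈ S, x ∈ A)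
    (hfin : ∀ x, (G.neighborSet x).Finite)
    (hcard : ∀ x, (L x).card = (G.neighborSet x).ncard) (g : X → Y) :
    ∃ c : X → Y, (∀ x ∈ S, c x ∈ L x) ∧ (∀ x ∈ S, ∀ y, G.Adj x y → y ∉ A → c x ≠ g y) ∧
      ∀ x ∈ S, ∀ y ∈ S, G.Adj x y → c x ≠ c y := by
  let E : X → Finset X := fun x => (hfin x).toFinset.filter fun y => y ∉ A
  obtain ⟨c, hc, hadj⟩ := hS (fun x => L x \ (E x).image g) fun x hx => by
    have h1 : degOn G S x + (E x).card ≤ (L x).card := by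
      have hdisj : Disjoint (S.filter (G.Adj x)) (E x) :=
        Finset.disjoint_left.2 fun y hy hy' =>
          (Finset.mem_filter.1 hy').2 (hSA y (Finset.mem_filter.1 hy).1)
      rw [hcard, Set.ncard_eq_toFinset_card _ (hfin x)]
      unfold degOn
      rw [← Finset.card_union_of_disjoint hdisj]
      refine Finset.card_le_card (Finset.union_subset (fun y hy => ?_)
        (Finset.filter_subset _ _))
      simpa using (Finset.mem_filter.1 hy).2
    have h2 := Finset.le_card_sdiff ((E x).image g) (L x)
    have h3 := Finset.card_image_le (s := E x) (f := g)
    simp only [Pi.zero_apply]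
    omega
  refine ⟨c, fun x hx => (Finset.mem_sdiff.1 (hc x hx)).1, fun x hx y hxy hy he => ?_, hadj⟩
  refine (Finset.mem_sdiff.1 (hc x hx)).2 (Finset.mem_image.2 ⟨y, ?_, he.symm⟩)
  exact Finset.mem_filter.2 ⟨by simpa using hxy, hy⟩

variable [MeasurableSpace X] [StandardBorelSpace X] [MeasurableSpace Y] [StandardBorelSpace Y]

lemma NeighborEnumeration.exists_measurable_coloring {G : SimpleGraph X} {N : ℕ → X → X}
    (h : NeighborEnumeration G N)
    (hG : ∀ c : G.ConnectedComponent, ¬ GallaiTree (G.induce c.supp))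
    {L : X → Finset Y} (hL : Measurable fun x => (L x).card)
    (hcard : ∀ x, (L x).card = (G.neighborSet x).ncard)
    {l : ℕ → X → Y} (hl : ∀ i, Measurable (l i))
    (hlL : ∀ x z, z ∈ L x ↔ ∃ i < (L x).card, l i x = z) :
    ∃ c : X → Y, Measurable c ∧ (∀ x, c x ∈ L x) ∧ ∀ x y, G.Adj x y → c x ≠ c y := by
  obtain ⟨D, J, hD, hJ, hDmeet, hDJ, hfar⟩ := h.exists_pieces Y hG
  have hDm : Measurable fun x => x ∈ D := measurableSet_setOfPred.1 hD
  let A : Set X := {y | ∃ s t, walk N s y ∈ D ∧ t ∈ J (walk N s y) ∧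
    walk N t (walk N s y) = y}
  have hbase : ∀ s t, Measurable fun y => walk N s y ∈ D ∧ t ∈ J (walk N s y) ∧
      walk N t (walk N s y) = y := fun s t =>
    (h.measurable_comp_walk hDm s).and ((h.measurable_comp_walk (hJ t) s).and
      (measurable_eq_prop ((h.measurable_walk t).comp (h.measurable_walk s)) measurable_id))
  have hA : MeasurableSet A := measurableSet_setOfPred.2 <|
    Measurable.exists fun s => Measurable.exists fun t => hbase s t
  have hAm : Measurable fun x => x ∈ A := measurableSet_setOfPred.1 hA
  have hmemA : ∀ x ∈ D, ∀ t ∈ J x, walk N t x ∈ A := fun x hx t ht => by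
    obtain ⟨s, hs⟩ := h.exists_walk (h.reachable_walk t x).symm
    exact ⟨s, t, by rw [hs]; exact ⟨hx, ht, rfl⟩⟩
  have hAmeet : ∀ x, ∃ s, walk N s x ∈ A := fun x => by
    obtain ⟨s, hs⟩ := hDmeet x
    obtain ⟨t, ht⟩ := (hDJ _ hs).1
    exact ⟨s ++ t, by rw [walk_append]; exact hmemA _ hs t ht⟩
  obtain ⟨κ, hκ, hκG⟩ := h.exists_coloring_nat
  obtain ⟨ρ, hρ, hρup, hρne⟩ := h.exists_rank hκ hκG hA hAmeet
  have : Countable (ℕ ×ₗ ℕ ×ₗ ℕ) := inferInstanceAs (Countable (ℕ × ℕ × ℕ))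
  obtain ⟨ind, hindm, hind⟩ := exists_greedy_index hρ h.measurable hl
  have hgreedy : ∀ x, x ∉ A → ind x < (L x).card ∧
      ∀ z, G.Adj x z → ρ z < ρ x → l (ind x) x ≠ l (ind z) z := fun x hx => by
    obtain ⟨y, hxy, hlt⟩ := hρup x hx
    exact greedy_index_spec (fun y hy => h.exists_of_adj hy)
      (fun k => (h.exists_iff x _).1 ⟨k, rfl⟩) (h.finite x) (hcard x)
      (fun z hz => (hlL x z).1 hz) (hind x) hxy hlt
  obtain ⟨e, he⟩ := exists_surjective_nat (List ℕ →₀ ℕ)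
  let valid : (List ℕ →₀ ℕ) → X → Prop := fun a x => ∀ t, t ∈ J x →
    a t < (L (walk N t x)).card ∧
    (∀ k, N k (walk N t x) ∉ A →
      l (a t) (walk N t x) ≠ l (ind (N k (walk N t x))) (N k (walk N t x))) ∧
    ∀ u, u ∈ J x → G.Adj (walk N t x) (walk N u x) →
      l (a t) (walk N t x) ≠ l (a u) (walk N u x)
  have hg : Measurable fun x => l (ind x) x := measurable_apply_index hl hindm
  have hvalid : ∀ a, Measurable (valid a) := fun a => by
    refine Measurable.forall fun t => (hJ t).imp (Measurable.and ?_ ((Measurable.forall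
      fun k => ?_).and (Measurable.forall fun u => (hJ u).imp ((h.measurable_adj
        (h.measurable_walk t) (h.measurable_walk u)).imp (measurable_eq_prop
          ((hl _).comp (h.measurable_walk t)) ((hl _).comp (h.measurable_walk u))).not))))
    · exact measurableSet_setOfPred.1
        (measurableSet_lt measurable_const (hL.comp (h.measurable_walk t)))
    · have hk := (h.measurable k).comp (h.measurable_walk t)
      exact (hAm.comp hk).not.imp (measurable_eq_prop ((hl _).comp (h.measurable_walk t))
        (hg.comp hk)).not
  have hex : ∀ x ∈ D, ∃ n, valid (e n) x := by
    intro x hx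
    obtain ⟨c, hcL, hcout, hcin⟩ := exists_extension_of_choosable (hDJ x hx).2 (A := A)
      (fun y hy => by
        obtain ⟨t, ht, rfl⟩ := mem_piece.1 hy
        exact hmemA x hx t ht) h.finite hcard (fun y => l (ind y) y)
    have hidx : ∀ t, ∃ i, t ∈ J x → i < (L (walk N t x)).card ∧
        l i (walk N t x) = c (walk N t x) := fun t => by
      by_cases ht : t ∈ J x
      · obtain ⟨i, hi⟩ := (hlL _ _).1 (hcL _ (mem_piece.2 ⟨t, ht, rfl⟩))
        exact ⟨i, fun _ => hi⟩
      · exact ⟨0, fun h => absurd h ht⟩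
    choose i hi using hidx
    obtain ⟨n, hn⟩ := he (Finsupp.onFinset (J x) (fun t => if t ∈ J x then i t else 0)
      fun t ht => by
        by_contra hcon
        exact ht (if_neg hcon))
    have hent : ∀ t ∈ J x, e n t = i t := fun t ht => by
      rw [hn, Finsupp.onFinset_apply, if_pos ht]
    refine ⟨n, fun t ht => ?_⟩
    have hmem : walk N t x ∈ piece N (J x) x := mem_piece.2 ⟨t, ht, rfl⟩
    rw [hent t ht, (hi t ht).2]
    refine ⟨(hi t ht).1, fun k hk => ?_, fun u hu hadj => ?_⟩
    · refine hcout _ hmem _ (h.adj_of_ne fun he => hk ?_) hk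
      rw [he]
      exact hmemA x hx t ht
    · rw [hent u hu, (hi u hu).2]
      exact hcin _ hmem _ (mem_piece.2 ⟨u, hu, rfl⟩) hadj
  let m : X → ℕ := fun x => sInf {n | valid (e n) x}
  have hm : Measurable m := measurable_sInf_setOf fun n => hvalid _
  have hmv : ∀ x ∈ D, valid (e (m x)) x := fun x hx =>
    Nat.sInf_mem (s := {n | valid (e n) x}) (hex x hx)
  obtain ⟨g, hgs⟩ := exists_surjective_nat (List ℕ × List ℕ)
  let q : X → ℕ := fun y => sInf {n | walk N (g n).1 y ∈ D ∧
    (g n).2 ∈ J (walk N (g n).1 y) ∧ walk N (g n).2 (walk N (g n).1 y) = y}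
  have hq : Measurable q := measurable_sInf_setOf fun n => hbase _ _
  let F : X → ℕ := fun y =>
    if y ∈ A then e (m (walk N (g (q y)).1 y)) (g (q y)).2 else ind y
  have hF : Measurable F := Measurable.ite hA (measurable_apply_index
    (N := fun n y => e (m (walk N (g n).1 y)) (g n).2) (fun n =>
      (measurable_from_nat (f := fun k => e k (g n).2)).comp
        (hm.comp (h.measurable_walk _))) hq) hindm
  have hFA : ∀ y ∈ A, ∃ x ∈ D, ∃ t ∈ J x, walk N t x = y ∧ F y = e (m x) t := by
    intro y hy
    have hmem : q y ∈ {n | walk N (g n).1 y ∈ D ∧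
        (g n).2 ∈ J (walk N (g n).1 y) ∧ walk N (g n).2 (walk N (g n).1 y) = y} := by
      refine Nat.sInf_mem ?_
      obtain ⟨s, t, hst⟩ := hy
      obtain ⟨n, hn⟩ := hgs (s, t)
      exact ⟨n, by rw [Set.mem_ofPred_eq, hn]; exact hst⟩
    exact ⟨_, hmem.1, _, hmem.2.1, hmem.2.2, if_pos hy⟩
  have hFnA : ∀ y, y ∉ A → F y = ind y := fun y hy => if_neg hy
  have hmixed : ∀ x y, x ∈ A → y ∉ A → G.Adj x y → l (F x) x ≠ l (F y) y := by
    intro y z hy hz hyz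
    obtain ⟨x, hx, t, ht, rfl, hFy⟩ := hFA y hy
    obtain ⟨k, rfl⟩ := h.exists_of_adj hyz
    rw [hFy, hFnA _ hz]
    exact (hmv x hx t ht).2.1 k hz
  refine ⟨fun y => l (F y) y, measurable_apply_index hl hF, fun y => ?_, fun y z hyz => ?_⟩
  · refine (hlL _ _).2 ⟨_, ?_, rfl⟩
    by_cases hy : y ∈ A
    · obtain ⟨x, hx, t, ht, rfl, hFy⟩ := hFA y hy
      rw [hFy]
      exact (hmv x hx t ht).1
    · rw [hFnA y hy]
      exact (hgreedy y hy).1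
  · by_cases hy : y ∈ A <;> by_cases hz : z ∈ A
    · obtain ⟨x, hx, t, ht, rfl, hFy⟩ := hFA y hy
      obtain ⟨x', hx', u, hu, rfl, hFz⟩ := hFA z hz
      obtain rfl := hfar x hx x' hx' t ht u hu (Or.inr hyz)
      dsimp only
      rw [hFy, hFz]
      exact (hmv x hx t ht).2.2 u hu hyz
    · exact hmixed y z hy hz hyz
    · exact (hmixed z y hz hy hyz.symm).symm
    · dsimp only
      rw [hFnA y hy, hFnA z hz]
      rcases lt_or_gt_of_ne (hρne y z hyz) with hlt | hlt
      · exact ((hgreedy z hz).2 y hyz.symm hlt).symm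
      · exact (hgreedy y hy).2 z hyz hlt

end Coloring

end DegreeList

theorem stmt_2 {X : Type*} [MeasurableSpace X] [StandardBorelSpace X]
    (G : SimpleGraph X) (hGmeas : MeasurableSet {p : X × X | G.Adj p.1 p.2})
    (hlf : ∀ x : X, (G.neighborSet x).Finite)
    (hnotgallai : ∀ c : G.ConnectedComponent, ¬ GallaiTree (G.induce c.supp))
    (Y : Type*) [TopologicalSpace Y] [MeasurableSpace Y] [PolishSpace Y] [BorelSpace Y]
    (L : X → Finset Y)
    (hLmeas : ∀ U : Set Y, IsOpen U → MeasurableSet {x : X | ∃ y ∈ L x, y ∈ U})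
    (hLcard : ∀ x : X, (L x).card = (G.neighborSet x).ncard) :
    ∃ c : X → Y, Measurable c ∧ (∀ x : X, c x ∈ L x) ∧
      ∀ x y : X, G.Adj x y → c x ≠ c y := by
  rcases isEmpty_or_nonempty X with hX | ⟨⟨x₀⟩⟩
  · exact ⟨fun x => isEmptyElim x, measurable_of_empty _, fun x => isEmptyElim x,
      fun x => isEmptyElim x⟩
  have hcard : Measurable fun x => (L x).card := DegreeList.measurable_card_of_hits hLmeas
  have hncard : ∀ x, (hlf x).toFinset.card = (L x).card := fun x => by
    rw [hLcard, Set.ncard_eq_toFinset_card _ (hlf x)]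
  obtain ⟨N, hN, hNG, hNd⟩ := DegreeList.exists_measurable_enumeration
    (fun x => (hlf x).toFinset) (by simpa using hGmeas) (by simpa only [hncard] using hcard)
    id measurable_id
  have h : DegreeList.NeighborEnumeration G N := by
    refine ⟨hN, fun x y => ⟨?_, ?_⟩, hlf⟩
    · rintro ⟨i, rfl⟩
      by_cases hi : i < (hlf x).toFinset.card
      · exact Or.inr (by simpa using (hNG x (N i x)).2 ⟨i, hi, rfl⟩)
      · exact Or.inl (hNd i x (not_lt.1 hi))
    · rintro (rfl | hxy)
      · exact ⟨_, hNd _ _ le_rfl⟩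
      · obtain ⟨i, -, hi⟩ := (hNG x y).1 (by simpa using hxy)
        exact ⟨i, hi⟩
  obtain ⟨y₀⟩ : Nonempty Y := by
    obtain ⟨S, ⟨v, hv⟩, -, hS⟩ := DegreeList.exists_choosable_of_not_gallaiTree Y
      (hnotgallai (G.connectedComponentMk x₀))
    obtain ⟨c, -⟩ := hS L fun x _ => by
      classical
      rw [← hncard]
      refine Finset.card_le_card fun y hy => ?_
      simpa using (@Finset.mem_filter _ _ (_) _ _ |>.1 hy).2
    exact ⟨c v⟩
  obtain ⟨l, hl, hlL, -⟩ := DegreeList.exists_measurable_enumeration L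
    (DegreeList.measurableSet_mem_of_hits hLmeas) hcard (fun _ => y₀) measurable_const
  exact h.exists_measurable_coloring hnotgallai hcard hLcard hl hlL
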